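/- arXiv:math/9909149 — 3 statements merged into one kernel-verified Lean document; each statement's English description precedes it below -/
import Mathlib

section
/- Let A be a commutative Banach algebra over ℂ. Then the topology τ_∞ is Hausdorff on Id(A) if and only if A has spectral synthesis in the usual sense, namely: (a) the hull-kernel topology coincides with the Gelfand topology on Prim(A) = {ker φ : φ a character of A} (Gelfand topology transported from the character space via the bijection φ ↦ ker φ), and (b) every proper closed ideal I of A equals the intersection of the kernels of the characters φ with I ⊆ ker φ. -/
set_option linter.unusedSectionVars false

open Filter Topology

section BanachAlgebraPrelude

variable (A : Type*) [NonUnitalNormedRing A] [NormedSpace ℂ A]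
  [IsScalarTower ℂ A A] [SMulCommClass ℂ A A] [CompleteSpace A]

/-- `I` is a two-sided ideal of `A` (a `ℂ`-subspace closed under multiplication by
arbitrary elements of `A` on both sides); not necessarily topologically closed. -/
def IsIdealSet (I : Set A) : Prop :=
  (0 : A) ∈ I ∧ (∀ x ∈ I, ∀ y ∈ I, x + y ∈ I) ∧
    (∀ (c : ℂ), ∀ x ∈ I, c • x ∈ I) ∧
    ∀ x ∈ I, ∀ a : A, a * x ∈ I ∧ x * a ∈ I

/-- `I` is a closed two-sided ideal of `A`. -/
def IsClosedIdeal (I : Set A) : Prop := IsClosed I ∧ IsIdealSet A I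

/-- `Id(A)`: the set of closed two-sided ideals of `A` (including `A` itself). -/
abbrev ClosedIdeals := {I : Set A // IsClosedIdeal A I}

/-- The quotient norm `‖a + I‖ = inf {‖a - m‖ : m ∈ I}`. -/
noncomputable def qnorm (a : A) (I : Set A) : ℝ := Metric.infDist a I

/-- `S_k(A)`: the set of algebra seminorms `ρ` on `A` with `ρ(a) ≤ k‖a‖`,
viewed as a subset of `A → ℝ` (so that it carries the topology of pointwise
convergence). -/
def SK (k : ℕ) : Set (A → ℝ) :=
  {ρ | (∀ a b, ρ (a + b) ≤ ρ a + ρ b) ∧ (∀ (c : ℂ) (a : A), ρ (c • a) = ‖c‖ * ρ a) ∧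
    (∀ a b, ρ (a * b) ≤ ρ a * ρ b) ∧ ∀ a, ρ a ≤ k * ‖a‖}

theorem sk_ker_isClosedIdeal {k : ℕ} {ρ : A → ℝ} (h : ρ ∈ SK A k) :
    IsClosedIdeal A {a | ρ a = 0} := by
  obtain ⟨h1, h2, h3, h4⟩ := h
  have hz : ρ 0 = 0 := by
    have := h2 0 0
    simpa using this
  have hnn : ∀ a, 0 ≤ ρ a := by
    intro a
    have hneg : ρ (-a) = ρ a := by
      have := h2 (-1) a
      simpa using this
    have h' := h1 a (-a)
    rw [show a + -a = (0 : A) by abel, hz, hneg] at h'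
    linarith
  have key : ∀ a b : A, ρ a - ρ b ≤ (k : ℝ) * ‖a - b‖ := by
    intro a b
    have e1 := h1 b (a - b)
    rw [show b + (a - b) = a by abel] at e1
    have e2 := h4 (a - b)
    linarith
  have hlip : LipschitzWith (k : NNReal) ρ := by
    apply LipschitzWith.of_dist_le_mul
    intro a b
    rw [Real.dist_eq, dist_eq_norm, abs_sub_le_iff]
    constructor
    · have := key a b; push_cast; linarith
    · have := key b a; rw [norm_sub_rev] at this; push_cast; linarith
  refine ⟨isClosed_eq hlip.continuous continuous_const, hz, ?_, ?_, ?_⟩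
  · intro x hx y hy
    have hx' : ρ x = 0 := hx
    have hy' : ρ y = 0 := hy
    have hle : ρ (x + y) ≤ 0 := by
      have := h1 x y
      rw [hx', hy'] at this
      linarith
    exact le_antisymm hle (hnn _)
  · intro c x hx
    have hx' : ρ x = 0 := hx
    show ρ (c • x) = 0
    rw [h2 c x, hx', mul_zero]
  · intro x hx a
    have hx' : ρ x = 0 := hx
    constructor
    · have hle : ρ (a * x) ≤ 0 := by
        have := h3 a x
        rw [hx', mul_zero] at this
        linarith
      exact le_antisymm hle (hnn _)
    · have hle : ρ (x * a) ≤ 0 := by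
        have := h3 x a
        rw [hx', zero_mul] at this
        linarith
      exact le_antisymm hle (hnn _)

/-- The kernel map `κ_k : S_k(A) → Id(A)`. -/
noncomputable def kerSK (k : ℕ) (ρ : SK A k) : ClosedIdeals A :=
  ⟨{a | ρ.1 a = 0}, sk_ker_isClosedIdeal A ρ.2⟩

/-- `τ_k`: the quotient topology on `Id(A)` induced by `κ_k`. -/
noncomputable def tauK (k : ℕ) : TopologicalSpace (ClosedIdeals A) :=
  TopologicalSpace.coinduced (kerSK A k) inferInstance

/-- `τ_∞`: the topology on `Id(A)` whose open sets are exactly the sets open in `τ_k`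
for every `k`. -/
noncomputable def tauInfty : TopologicalSpace (ClosedIdeals A) := ⨆ k, tauK A k

/-- A character of `A`: a nonzero continuous `ℂ`-algebra homomorphism `A → ℂ`. -/
def IsCharacter (φ : A → ℂ) : Prop :=
  φ ≠ 0 ∧ Continuous φ ∧ (∀ x y, φ (x + y) = φ x + φ y) ∧
    (∀ (c : ℂ) (x : A), φ (c • x) = c * φ x) ∧ ∀ x y, φ (x * y) = φ x * φ y

/-- The character space of `A`, as a subset of `A → ℂ`; its subspace topology is
the topology of pointwise convergence, i.e. the (relative weak-*) Gelfand topology. -/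
abbrev Characters := {φ : A → ℂ // IsCharacter A φ}

/-- The kernel of a character, as a subset of `A`. -/
def charKer (φ : A → ℂ) : Set A := {a | φ a = 0}

theorem charKer_isClosedIdeal {φ : A → ℂ} (h : IsCharacter A φ) :
    IsClosedIdeal A (charKer A φ) := by
  obtain ⟨-, hc, hadd, hsmul, hmul⟩ := h
  have hz : φ 0 = 0 := by
    have := hsmul 0 0
    simpa using this
  refine ⟨isClosed_eq hc continuous_const, hz, ?_, ?_, ?_⟩
  · intro x hx y hy
    have hx' : φ x = 0 := hx
    have hy' : φ y = 0 := hy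
    show φ (x + y) = 0
    rw [hadd, hx', hy', add_zero]
  · intro c x hx
    have hx' : φ x = 0 := hx
    show φ (c • x) = 0
    rw [hsmul, hx', mul_zero]
  · intro x hx a
    have hx' : φ x = 0 := hx
    exact ⟨by show φ (a * x) = 0; rw [hmul, hx', mul_zero],
      by show φ (x * a) = 0; rw [hmul, hx', zero_mul]⟩

/-- The kernel of a character, as an element of `Id(A)`. -/
noncomputable def charKerIdeal (φ : Characters A) : ClosedIdeals A :=
  ⟨charKer A φ.1, charKer_isClosedIdeal A φ.2⟩

/-- `Prim(A) = {ker φ : φ a character of A}` (also called `M′`),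
as a subset of `Id(A)`. -/
def PrimSet : Set (ClosedIdeals A) := Set.range (charKerIdeal A)

/-- The map `φ ↦ ker φ` from the character space onto `Prim(A)`. -/
noncomputable def gelfandMap (φ : Characters A) : PrimSet A :=
  ⟨charKerIdeal A φ, ⟨φ, rfl⟩⟩

/-- The Gelfand topology on `Prim(A)`, transported from the character space via
`φ ↦ ker φ`. -/
noncomputable def gelfandTop : TopologicalSpace (PrimSet A) :=
  TopologicalSpace.coinduced (gelfandMap A) inferInstance

/-- The lower topology `τ_w` on `Id(A)`, generated by the sets
`{I : I ⊉ J}`; its restriction to any set of (prime) ideals is the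
hull-kernel topology. -/
def tauW : TopologicalSpace (ClosedIdeals A) :=
  TopologicalSpace.generateFrom {U | ∃ J : ClosedIdeals A, U = {I | ¬ J.1 ⊆ I.1}}

/-- The restriction of a topology on `Id(A)` to a subset `X ⊆ Id(A)`. -/
def restrictTop (X : Set (ClosedIdeals A)) (t : TopologicalSpace (ClosedIdeals A)) :
    TopologicalSpace X :=
  TopologicalSpace.induced Subtype.val t

/-- `P` is a proper closed prime two-sided ideal of `A`: for all closed two-sided
ideals `I`, `J`, if `I·J ⊆ P` then `I ⊆ P` or `J ⊆ P`. -/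
def IsPrimeIdealSet (P : Set A) : Prop :=
  IsClosedIdeal A P ∧ P ≠ Set.univ ∧
    ∀ I J : ClosedIdeals A, (∀ x ∈ I.1, ∀ y ∈ J.1, x * y ∈ P) → I.1 ⊆ P ∨ J.1 ⊆ P

/-- `Prime(A)`: the set of proper closed prime two-sided ideals of `A`. -/
def PrimeSet : Set (ClosedIdeals A) := {P | IsPrimeIdealSet A P.1}

/-- A topology `t` on a subset `X ⊆ Id(A)` has the normality property if every
net converging in `t` has the normality property with respect to each of its
limits: whenever `I_α → I (t)` and `a ∉ I`, `liminf_α ‖a + I_α‖ > 0`. -/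
def HasNormality (X : Set (ClosedIdeals A)) (t : TopologicalSpace X) : Prop :=
  ∀ (D : Type) [Preorder D], (atTop : Filter D).NeBot →
    ∀ (net : D → X) (I : X),
      Filter.Tendsto net atTop (@nhds _ t I) →
        ∀ a : A, a ∉ I.1.1 →
          0 < Filter.liminf (fun d => qnorm A a (net d).1.1) atTop

namespace SSX
section Q
variable {Q : Type*} [NormedCommRing Q] [NormedAlgebra ℂ Q] [CompleteSpace Q]

theorem pow_bound (a : Q) {δ r : ℝ} (hδ : 0 ≤ δ) (hr : δ < r)
    (h : ∀ χ : Q →ₐ[ℂ] ℂ, ‖χ a‖ ≤ δ) :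
    ∃ M : ℝ, 1 ≤ M ∧ ∀ n : ℕ, ‖a ^ n‖ ≤ M * r ^ n := by
  have hr0 : 0 < r := hδ.trans_lt hr
  have hsr : spectralRadius ℂ a < ENNReal.ofReal r := by
    refine lt_of_le_of_lt (b := ENNReal.ofReal δ) ?_ ((ENNReal.ofReal_lt_ofReal_iff hr0).2 hr)
    refine iSup₂_le fun z hz => ?_
    rcases subsingleton_or_nontrivial Q with hs | hs
    · exact absurd hz (by simp)
    rw [WeakDual.CharacterSpace.mem_spectrum_iff_exists] at hz
    obtain ⟨f, rfl⟩ := hz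
    have := h (WeakDual.CharacterSpace.toAlgHom f)
    rw [ENNReal.ofReal, ENNReal.coe_le_coe]
    exact NNReal.le_toNNReal_of_coe_le this
  have ht := spectrum.pow_norm_pow_one_div_tendsto_nhds_spectralRadius a
  have hev := (ht.eventually (gt_mem_nhds hsr)).and (eventually_ge_atTop 1)
  obtain ⟨N, hN⟩ := eventually_atTop.1 hev
  have hbig : ∀ n ≥ N, ‖a ^ n‖ ≤ r ^ n := by
    intro n hn
    obtain ⟨h1, h2⟩ := hN n hn
    have h3 := (ENNReal.ofReal_lt_ofReal_iff hr0).1 h1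
    have hn0 : (n : ℝ) ≠ 0 := by positivity
    have : (‖a ^ n‖ ^ (1 / n : ℝ)) ^ n ≤ r ^ n := by gcongr
    rwa [← Real.rpow_natCast (_ ^ _) n, ← Real.rpow_mul (norm_nonneg _), one_div_mul_cancel hn0,
      Real.rpow_one] at this
  refine ⟨1 + ∑ n ∈ Finset.range N, ‖a ^ n‖ / r ^ n, ?_, fun n => ?_⟩
  · have : 0 ≤ ∑ n ∈ Finset.range N, ‖a ^ n‖ / r ^ n := Finset.sum_nonneg fun _ _ => by positivity
    linarith
  · have hnn : 0 ≤ ∑ n ∈ Finset.range N, ‖a ^ n‖ / r ^ n :=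
      Finset.sum_nonneg fun _ _ => by positivity
    have hrn : 0 < r ^ n := by positivity
    rcases le_or_gt N n with hn | hn
    · nlinarith [hbig n hn, mul_nonneg hnn hrn.le]
    · have := Finset.single_le_sum (f := fun n => ‖a ^ n‖ / r ^ n) (fun i _ => by positivity)
        (Finset.mem_range.2 hn)
      have h2 : ‖a ^ n‖ / r ^ n ≤ 1 + ∑ n ∈ Finset.range N, ‖a ^ n‖ / r ^ n := by
        linarith
      rwa [div_le_iff₀ hrn] at h2

theorem catalan_le (n : ℕ) : catalan n ≤ 4 ^ n := by
  rw [catalan_eq_centralBinom_div]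
  exact (Nat.div_le_self _ _).trans (Nat.centralBinom_le_four_pow n)

theorem catalan_exists (d : Q) (h : ∀ χ : Q →ₐ[ℂ] ℂ, ‖χ d‖ ≤ 1 / 8) :
    ∃ c : Q, c = 1 + d * c ^ 2 ∧ ∀ χ : Q →ₐ[ℂ] ℂ, ‖χ c‖ ≤ 2 := by
  obtain ⟨M, hM, hb⟩ := pow_bound d (r := 1 / 6) (by norm_num) (by norm_num) h
  let f : ℕ → Q := fun n => (catalan n : ℂ) • d ^ n
  have hf : Summable fun n => ‖f n‖ := by
    refine Summable.of_nonneg_of_le (fun _ => norm_nonneg _) (f := fun n => M * (4 / 6) ^ n)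
      (fun n => ?_) ((summable_geometric_of_lt_one (by norm_num) (by norm_num)).mul_left M)
    have h4 : (catalan n : ℝ) ≤ 4 ^ n := by exact_mod_cast catalan_le n
    calc ‖f n‖ = catalan n * ‖d ^ n‖ := by simp [f, norm_smul]
      _ ≤ 4 ^ n * (M * (1 / 6) ^ n) := by gcongr; exact hb n
      _ = M * (4 / 6) ^ n := by
        rw [show (4 / 6 : ℝ) = 4 * (1 / 6) by norm_num, mul_pow]; ring
  have hs : Summable f := hf.of_norm
  refine ⟨∑' n, f n, ?_, fun χ => ?_⟩
  · rw [pow_two, tsum_mul_tsum_eq_tsum_sum_antidiagonal_of_summable_norm hf hf, hs.tsum_eq_zero_add,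
      ← (summable_norm_sum_mul_antidiagonal_of_summable_norm hf hf).of_norm.tsum_mul_left]
    congr 1
    · simp [f]
    · refine tsum_congr fun n => ?_
      simp only [f, catalan_succ', Nat.cast_sum, Finset.sum_smul, Finset.mul_sum]
      refine Finset.sum_congr rfl fun p hp => ?_
      have hp := Finset.HasAntidiagonal.mem_antidiagonal.1 hp
      simp only [Algebra.smul_def, Nat.cast_mul, map_mul]
      rw [← hp, pow_succ, pow_add]; ring
  · have hc : Continuous χ := (AlgHom.toContinuousLinearMap χ).continuous
    have h1 : χ (∑' n, f n) = ∑' n, χ (f n) := hs.map_tsum χ hc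
    have hg : HasSum (fun n : ℕ => (1 / 2 : ℝ) ^ n) 2 := hasSum_geometric_two
    rw [h1]
    refine tsum_of_norm_bounded hg fun n => ?_
    have h4 : (catalan n : ℝ) ≤ 4 ^ n := by exact_mod_cast catalan_le n
    calc ‖χ (f n)‖ = catalan n * ‖χ d‖ ^ n := by simp [f]
      _ ≤ 4 ^ n * (1 / 8) ^ n := by gcongr; exact h χ
      _ = (1 / 2) ^ n := by rw [← mul_pow]; norm_num

theorem exists_small_norm (a : Q) (h : ∀ χ : Q →ₐ[ℂ] ℂ, χ a = 0) {ε : ℝ} (hε : 0 < ε) :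
    ∃ p : Q → ℝ, (∀ x y, p (x + y) ≤ p x + p y) ∧ (∀ (c : ℂ) x, p (c • x) = ‖c‖ * p x) ∧
      (∀ x y, p (x * y) ≤ p x * p y) ∧ (∀ x, p x ≤ ‖x‖) ∧ p a ≤ ε ∧ ∀ x, p x = 0 → x = 0 := by
  obtain ⟨M, hM, hb⟩ := pow_bound a (r := ε) le_rfl hε (fun χ => by simp [h χ])
  -- auxiliary norm
  let N : Q → ℝ := fun y => ⨆ n : ℕ, ‖y * a ^ n‖ / ε ^ n
  have hterm : ∀ y n, ‖y * a ^ n‖ / ε ^ n ≤ ‖y‖ * M := by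
    intro y n
    have : 0 < ε ^ n := by positivity
    rw [div_le_iff₀ this]
    calc ‖y * a ^ n‖ ≤ ‖y‖ * ‖a ^ n‖ := norm_mul_le _ _
      _ ≤ ‖y‖ * (M * ε ^ n) := by gcongr; exact hb n
      _ = _ := by ring
  have hbdd : ∀ y, BddAbove (Set.range fun n : ℕ => ‖y * a ^ n‖ / ε ^ n) := fun y =>
    ⟨‖y‖ * M, by rintro _ ⟨n, rfl⟩; exact hterm y n⟩
  have hle : ∀ y n, ‖y * a ^ n‖ / ε ^ n ≤ N y := fun y n => le_ciSup (hbdd y) n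
  have hNle : ∀ y C, (∀ n : ℕ, ‖y * a ^ n‖ / ε ^ n ≤ C) → N y ≤ C := fun y C hC => ciSup_le hC
  have hN0 : ∀ y, 0 ≤ N y := fun y => (by positivity : (0:ℝ) ≤ _).trans (hle y 0)
  have hnN : ∀ y, ‖y‖ ≤ N y := fun y => by simpa using hle y 0
  have hNmul : ∀ x y, N (x * y) ≤ ‖x‖ * N y := fun x y => hNle _ _ fun n => by
    calc ‖x * y * a ^ n‖ / ε ^ n ≤ (‖x‖ * ‖y * a ^ n‖) / ε ^ n := by
          gcongr; rw [mul_assoc]; exact norm_mul_le _ _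
      _ = ‖x‖ * (‖y * a ^ n‖ / ε ^ n) := by ring
      _ ≤ _ := by gcongr; exact hle y n
  have hNadd : ∀ x y, N (x + y) ≤ N x + N y := fun x y => hNle _ _ fun n => by
    calc ‖(x + y) * a ^ n‖ / ε ^ n ≤ (‖x * a ^ n‖ + ‖y * a ^ n‖) / ε ^ n := by
          gcongr; rw [add_mul]; exact norm_add_le _ _
      _ = ‖x * a ^ n‖ / ε ^ n + ‖y * a ^ n‖ / ε ^ n := by ring
      _ ≤ _ := add_le_add (hle x n) (hle y n)
  have hNsmul : ∀ (c : ℂ) x, N (c • x) ≤ ‖c‖ * N x := fun c x => hNle _ _ fun n => by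
    rw [smul_mul_assoc, norm_smul, mul_div_assoc]
    gcongr; exact hle x n
  have hNa : ∀ y, N (a * y) ≤ ε * N y := fun y => hNle _ _ fun n => by
    have := hle y (n + 1)
    have hp : 0 < ε ^ n := by positivity
    rw [div_le_iff₀ (by positivity), pow_succ, pow_succ] at this
    rw [div_le_iff₀ hp, show a * y * a ^ n = y * (a ^ n * a) by ring]
    linarith
  let S : Q → Set ℝ := fun x => {C | 0 ≤ C ∧ ∀ y, N (x * y) ≤ C * N y}
  have hSb : ∀ x, BddBelow (S x) := fun x => ⟨0, fun C hC => hC.1⟩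
  have hSn : ∀ x, ‖x‖ ∈ S x := fun x => ⟨norm_nonneg _, hNmul x⟩
  let p : Q → ℝ := fun x => sInf (S x)
  have hp0 : ∀ x, 0 ≤ p x := fun x => le_csInf ⟨_, hSn x⟩ fun C hC => hC.1
  have hple : ∀ x C, C ∈ S x → p x ≤ C := fun x C hC => csInf_le (hSb x) hC
  have hpS : ∀ x, p x ∈ S x := by
    intro x
    refine ⟨hp0 x, fun y => ?_⟩
    rcases (hN0 y).eq_or_lt with h0 | h0
    · have := hNmul x y
      rw [← h0] at this ⊢
      simpa using this
    · rw [← div_le_iff₀ h0]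
      refine le_csInf ⟨_, hSn x⟩ fun C hC => ?_
      rw [div_le_iff₀ h0]; exact hC.2 y
  have hsm : ∀ (c : ℂ) x, p (c • x) ≤ ‖c‖ * p x := fun c x => hple _ _
    ⟨mul_nonneg (norm_nonneg _) (hp0 x), fun y => by
      rw [smul_mul_assoc, mul_assoc]
      exact (hNsmul _ _).trans (by gcongr; exact (hpS x).2 y)⟩
  refine ⟨p, ?_, ?_, ?_, fun x => hple _ _ (hSn x), hple _ _ ⟨hε.le, hNa⟩, ?_⟩
  · intro x y
    refine hple _ _ ⟨add_nonneg (hp0 x) (hp0 y), fun z => ?_⟩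
    rw [add_mul, add_mul]
    exact (hNadd _ _).trans (add_le_add ((hpS x).2 z) ((hpS y).2 z))
  · intro c x
    refine le_antisymm (hsm c x) ?_
    rcases eq_or_ne c 0 with rfl | hc
    · simpa using hp0 _
    · have := hsm c⁻¹ (c • x)
      rw [smul_smul, inv_mul_cancel₀ hc, one_smul, norm_inv] at this
      rwa [← div_eq_inv_mul, le_div_iff₀ (by positivity), mul_comm] at this
  · intro x y
    refine hple _ _ ⟨mul_nonneg (hp0 x) (hp0 y), fun z => ?_⟩
    rw [mul_assoc, mul_assoc]
    exact ((hpS x).2 _).trans (mul_le_mul_of_nonneg_left ((hpS y).2 z) (hp0 x))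
  · intro x hx
    have := (hpS x).2 1
    rw [hx, zero_mul, mul_one] at this
    exact norm_le_zero_iff.1 ((hnN x).trans this)

end Q
end SSX

namespace SSX
section R
universe u
variable {R : Type u} [NonUnitalNormedCommRing R] [NormedSpace ℂ R]
  [IsScalarTower ℂ R R] [SMulCommClass ℂ R R] [CompleteSpace R]

@[reducible]
noncomputable def commU : NormedCommRing (WithLp 1 (Unitization ℂ R)) :=
  { WithLp.instUnitizationNormedRing with
    mul_comm := fun x y => WithLp.ofLp_injective 1 (mul_comm (WithLp.ofLp x) (WithLp.ofLp y)) }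

noncomputable def extHom (ψ : Characters R) : WithLp 1 (Unitization ℂ R) →ₐ[ℂ] ℂ :=
  (Unitization.lift
    ({ toFun := ψ.1
       map_smul' := fun c x => by simpa using ψ.2.2.2.2.1 c x
       map_zero' := by simpa using ψ.2.2.2.2.1 0 0
       map_add' := ψ.2.2.2.1
       map_mul' := ψ.2.2.2.2.2 } : R →ₙₐ[ℂ] ℂ)).comp
    (WithLp.unitizationAlgEquiv (𝕜 := ℂ) (A := R) ℂ).toAlgHom

theorem extHom_inr (ψ : Characters R) (a : R) :
    extHom ψ (WithLp.toLp 1 (a : Unitization ℂ R)) = ψ.1 a := by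
  simp [extHom]

theorem unit_exists :
    ∃ (B : Type u) (_ : NormedCommRing B) (_ : NormedAlgebra ℂ B) (_ : CompleteSpace B)
      (ι : R → B), (∀ a b, ι (a + b) = ι a + ι b) ∧ (∀ (c : ℂ) a, ι (c • a) = c • ι a) ∧
      (∀ a b, ι (a * b) = ι a * ι b) ∧ Isometry ι ∧
      (∀ y : B, ∃ (c : ℂ) (b : R), y = algebraMap ℂ B c + ι b) ∧
      ∀ ψ : Characters R, ∃ χ : B →ₐ[ℂ] ℂ, ∀ a, χ (ι a) = ψ.1 a := by
  refine ⟨WithLp 1 (Unitization ℂ R), commU, { WithLp.instUnitizationNormedAlgebra with },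
    WithLp.instCompleteSpace ℂ R, fun x => WithLp.toLp 1 (x : Unitization ℂ R), ?_, ?_, ?_, ?_, ?_, ?_⟩
  · intro a b; exact WithLp.ofLp_injective 1 (Unitization.inr_add ℂ a b)
  · intro c a; exact WithLp.ofLp_injective 1 (Unitization.inr_smul ℂ c a)
  · intro a b; exact WithLp.ofLp_injective 1 (Unitization.inr_mul ℂ a b)
  · exact WithLp.unitization_isometry_inr
  · intro y
    exact ⟨(WithLp.ofLp y).fst, (WithLp.ofLp y).snd,
      WithLp.ofLp_injective 1 (Unitization.inl_fst_add_inr_snd_eq (WithLp.ofLp y)).symm⟩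
  · intro ψ
    exact ⟨extHom ψ, extHom_inr ψ⟩

theorem quot_exists (I : ClosedIdeals R) :
    ∃ (Q : Type u) (_ : NormedCommRing Q) (_ : NormedAlgebra ℂ Q) (_ : CompleteSpace Q)
      (π : R → Q), (∀ a b, π (a + b) = π a + π b) ∧ (∀ (c : ℂ) a, π (c • a) = c • π a) ∧
      (∀ a b, π (a * b) = π a * π b) ∧ (∀ a, ‖π a‖ ≤ ‖a‖) ∧ (∀ a, π a = 0 ↔ a ∈ I.1) ∧
      (∀ y : Q, ∃ (c : ℂ) (b : R), y = algebraMap ℂ Q c + π b) ∧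
      ∀ ψ : Characters R, I.1 ⊆ charKer R ψ.1 → ∃ χ : Q →ₐ[ℂ] ℂ, ∀ a, χ (π a) = ψ.1 a := by
  obtain ⟨I, hcl, h0, hadd, hsm, hmul⟩ := I
  obtain ⟨B, _, _, _, ι, hιadd, hιsmul, hιmul, hiso, hdec, hext⟩ := unit_exists (R := R)
  let J : Ideal B :=
    { carrier := ι '' I
      zero_mem' := ⟨0, h0, by simpa using hιsmul 0 0⟩
      add_mem' := by
        rintro _ _ ⟨a, ha, rfl⟩ ⟨b, hb, rfl⟩
        exact ⟨a + b, hadd a ha b hb, hιadd a b⟩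
      smul_mem' := by
        rintro y _ ⟨a, ha, rfl⟩
        obtain ⟨c, b, rfl⟩ := hdec y
        refine ⟨c • a + b * a, hadd _ (hsm _ _ ha) _ (hmul a ha _).1, ?_⟩
        rw [hιadd, hιsmul, hιmul, smul_eq_mul, add_mul, Algebra.smul_def] }
  have hJ : IsClosed (J : Set B) := hiso.isClosedEmbedding.isClosedMap _ hcl
  have hmem : ∀ a, ι a ∈ J ↔ a ∈ I := fun a =>
    ⟨fun ⟨b, hb, hab⟩ => hiso.injective hab ▸ hb, fun h => ⟨a, h, rfl⟩⟩
  have hnorm : ∀ a, ‖ι a‖ = ‖a‖ := fun a => by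
    have h00 : ι 0 = 0 := by simpa using hιsmul 0 0
    have := hiso.dist_eq a 0
    rwa [h00, dist_zero_right, dist_zero_right] at this
  refine ⟨B ⧸ J, inferInstance, inferInstance, ?_,
    fun a => Ideal.Quotient.mk J (ι a), ?_, ?_, ?_, ?_, ?_, ?_, ?_⟩
  · exact inferInstanceAs (CompleteSpace (B ⧸ Submodule.toAddSubgroup J))
  · intro a b; simp only [hιadd, map_add]
  · intro c a; simp only [hιsmul]; rfl
  · intro a b; simp only [hιmul, map_mul]
  · intro a
    exact (Ideal.Quotient.norm_mk_le J _).trans (hnorm a).le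
  · intro a; rw [Ideal.Quotient.eq_zero_iff_mem, hmem]
  · intro y
    obtain ⟨y, rfl⟩ := Ideal.Quotient.mk_surjective y
    obtain ⟨c, b, rfl⟩ := hdec y
    exact ⟨c, b, by rw [map_add]; rfl⟩
  · intro ψ hψ
    obtain ⟨χ, hχ⟩ := hext ψ
    refine ⟨Ideal.Quotient.liftₐ J χ ?_, fun a => ?_⟩
    · rintro _ ⟨a, ha, rfl⟩
      exact (hχ a).trans (hψ ha)
    · exact (Ideal.Quotient.lift_mk J _ _).trans (hχ a)

theorem char_norm_le (ψ : Characters R) (a : R) : ‖ψ.1 a‖ ≤ ‖a‖ := by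
  by_contra hlt
  push Not at hlt
  let I : ClosedIdeals R := ⟨charKer R ψ.1, charKer_isClosedIdeal R ψ.2⟩
  obtain ⟨Q, _, _, _, π, -, hs, -, hn, -, -, hχ⟩ := quot_exists I
  obtain ⟨χ, hχ⟩ := hχ ψ subset_rfl
  have h0 : ψ.1 a ≠ 0 := fun h => by
    rw [h, norm_zero] at hlt; exact absurd (norm_nonneg a) hlt.not_ge
  have hpos : 0 < ‖ψ.1 a‖ := norm_pos_iff.2 h0
  have hu : IsUnit (1 - (ψ.1 a)⁻¹ • π a) := by
    refine isUnit_one_sub_of_norm_lt_one ?_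
    rw [norm_smul, norm_inv, ← div_eq_inv_mul, div_lt_one hpos]
    exact (hn a).trans_lt hlt
  have h1 := hu.map χ
  rw [map_sub, map_one, map_smul, hχ, smul_eq_mul, inv_mul_cancel₀ h0, sub_self] at h1
  exact not_isUnit_zero h1

/-- Characters of the quotient restrict to characters or zero. -/
theorem hom_bound (I : ClosedIdeals R) (a : R) {δ : ℝ} (hδ : 0 ≤ δ)
    (h : ∀ ψ : Characters R, I.1 ⊆ charKer R ψ.1 → ‖ψ.1 a‖ ≤ δ)
    {Q : Type*} [NormedCommRing Q] [NormedAlgebra ℂ Q] [CompleteSpace Q]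
    (π : R → Q) (ha : ∀ a b, π (a + b) = π a + π b) (hs : ∀ (c : ℂ) a, π (c • a) = c • π a)
    (hm : ∀ a b, π (a * b) = π a * π b) (hn : ∀ a, ‖π a‖ ≤ ‖a‖) (hk : ∀ a, π a = 0 ↔ a ∈ I.1)
    (χ : Q →ₐ[ℂ] ℂ) : ‖χ (π a)‖ ≤ δ := by
  by_cases h0 : (fun a => χ (π a)) = 0
  · have := congrFun h0 a
    simp only [Pi.zero_apply] at this
    rw [this, norm_zero]; exact hδ
  · have hπ : Continuous π :=
      (LinearMap.mkContinuous (⟨⟨π, ha⟩, hs⟩ : R →ₗ[ℂ] Q) 1 (fun x => by simpa using hn x)).continuous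
    have hc : Continuous χ := (AlgHom.toContinuousLinearMap χ).continuous
    refine h ⟨fun a => χ (π a), h0, hc.comp hπ, ?_, ?_, ?_⟩ ?_
    · intro x y; simp only [ha, map_add]
    · intro c x; simp only [hs, map_smul, smul_eq_mul]
    · intro x y; simp only [hm, map_mul]
    · intro x hx
      show χ (π x) = 0
      rw [(hk x).2 hx, map_zero]

/-! ### Characters -/

theorem char_eq (ψ φ : Characters R) (h : charKer R ψ.1 ⊆ charKer R φ.1) : ψ = φ := by
  revert h
  obtain ⟨ψ, hψ0, -, hψa, hψs, hψm⟩ := ψ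
  obtain ⟨φ, hφ0, -, hφa, hφs, hφm⟩ := φ
  intro hsub
  have h : ∀ a, ψ a = 0 → φ a = 0 := fun a ha => hsub ha
  obtain ⟨e, he⟩ := Function.ne_iff.1 hφ0
  simp only [Pi.zero_apply] at he
  have hψe : ψ e ≠ 0 := fun h0 => he (h _ h0)
  have key : ∀ a, ψ e * φ a = ψ a * φ e := by
    intro a
    have h1 : ψ (ψ e • a + (-ψ a) • e) = 0 := by rw [hψa, hψs, hψs]; ring
    have h2 : φ (ψ e • a + (-ψ a) • e) = 0 := h _ h1
    rw [hφa, hφs, hφs] at h2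
    linear_combination h2
  have hee : ψ e = φ e := by
    have := key (e * e)
    rw [hψm, hφm] at this
    have h3 : (ψ e * φ e) * (φ e - ψ e) = 0 := by linear_combination this
    rcases mul_eq_zero.1 h3 with h4 | h4
    · exact absurd h4 (mul_ne_zero hψe he)
    · exact (sub_eq_zero.1 h4).symm
  refine Subtype.ext (funext fun a => ?_)
  have := key a
  rw [← hee, mul_comm] at this
  exact (mul_right_cancel₀ hψe this).symm

variable (R) in
/-- characters together with zero -/
def XS : Set (R → ℂ) :=
  {χ | (∀ x y, χ (x + y) = χ x + χ y) ∧ (∀ (c : ℂ) x, χ (c • x) = c * χ x) ∧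
    (∀ x y, χ (x * y) = χ x * χ y) ∧ ∀ a, ‖χ a‖ ≤ ‖a‖}

theorem XS_compact : IsCompact (XS R) := by
  refine IsCompact.of_isClosed_subset
    (isCompact_univ_pi fun a : R => isCompact_closedBall (0 : ℂ) ‖a‖) ?_ ?_
  · have e : XS R = (⋂ x, ⋂ y, {χ : R → ℂ | χ (x + y) = χ x + χ y}) ∩
        ((⋂ c : ℂ, ⋂ x, {χ : R → ℂ | χ (c • x) = c * χ x}) ∩
        ((⋂ x, ⋂ y, {χ : R → ℂ | χ (x * y) = χ x * χ y}) ∩ ⋂ a, {χ : R → ℂ | ‖χ a‖ ≤ ‖a‖})) := by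
      ext χ; simp [XS]
    rw [e]
    refine IsClosed.inter (isClosed_iInter fun x => isClosed_iInter fun y =>
        isClosed_eq (by fun_prop) (by fun_prop)) (IsClosed.inter
      (isClosed_iInter fun x => isClosed_iInter fun y => isClosed_eq (by fun_prop) (by fun_prop))
      (IsClosed.inter (isClosed_iInter fun x => isClosed_iInter fun y =>
        isClosed_eq (by fun_prop) (by fun_prop))
      (isClosed_iInter fun x => isClosed_le (by fun_prop) (by fun_prop))))
  · intro χ hχ a _
    simpa using hχ.2.2.2 a

theorem XS_char {χ : R → ℂ} (h : χ ∈ XS R) (h0 : χ ≠ 0) : IsCharacter R χ := by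
  obtain ⟨ha, hs, hm, hn⟩ := h
  exact ⟨h0, (LinearMap.mkContinuous (⟨⟨χ, ha⟩, hs⟩ : R →ₗ[ℂ] ℂ) 1
    (fun x => by simpa using hn x)).continuous, ha, hs, hm⟩

theorem char_XS (ψ : Characters R) : ψ.1 ∈ XS R :=
  ⟨ψ.2.2.2.1, ψ.2.2.2.2.1, ψ.2.2.2.2.2, char_norm_le ψ⟩

theorem char_zero (ψ : Characters R) : ψ.1 0 = 0 := by simpa using ψ.2.2.2.2.1 0 0

theorem char_sub (ψ : Characters R) (a b : R) : ψ.1 (a - b) = ψ.1 a - ψ.1 b := by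
  have h1 := ψ.2.2.2.1 a ((-1 : ℂ) • b)
  rw [ψ.2.2.2.2.1, neg_one_smul, ← sub_eq_add_neg] at h1
  rw [h1]; ring

/-- kernel of a set of characters -/
def kerOf (K : Set (Characters R)) : ClosedIdeals R :=
  ⟨{a | ∀ ψ ∈ K, ψ.1 a = 0}, by
    have e : {a : R | ∀ ψ ∈ K, ψ.1 a = 0} = ⋂ ψ ∈ K, charKer R ψ.1 := by
      ext a; simp [charKer]
    rw [e]
    exact isClosed_biInter fun ψ _ => (charKer_isClosedIdeal R ψ.2).1,
   fun ψ _ => char_zero ψ,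
   fun x hx y hy ψ h => by rw [ψ.2.2.2.1, hx ψ h, hy ψ h, add_zero],
   fun c x hx ψ h => by rw [ψ.2.2.2.2.1, hx ψ h, mul_zero],
   fun x hx a => ⟨fun ψ h => by rw [ψ.2.2.2.2.2, hx ψ h, mul_zero],
     fun ψ h => by rw [ψ.2.2.2.2.2, hx ψ h, zero_mul]⟩⟩

theorem mem_kerOf {K : Set (Characters R)} {a : R} :
    a ∈ (kerOf K).1 ↔ ∀ ψ ∈ K, ψ.1 a = 0 := Iff.rfl

variable (R) in
def Reg : Prop := ∀ F : Set (Characters R), IsClosed F → ∀ φ, φ ∉ F →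
  ∃ a, φ.1 a ≠ 0 ∧ ∀ ψ ∈ F, ψ.1 a = 0

theorem char_exists_ne (φ : Characters R) : ∃ a, φ.1 a ≠ 0 := by
  obtain ⟨e, he⟩ := Function.ne_iff.1 φ.2.1
  exact ⟨e, he⟩

theorem cont_eval (x : R) : Continuous fun ψ : Characters R => ψ.1 x :=
  (continuous_apply x).comp continuous_subtype_val

theorem reg_iff : restrictTop R (PrimSet R) (tauW R) = gelfandTop R ↔ Reg R := by
  constructor
  · intro h F hF φ hφ
    have hU : @IsOpen _ (gelfandTop R) (gelfandMap R '' Fᶜ) := by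
      show IsOpen (gelfandMap R ⁻¹' (gelfandMap R '' Fᶜ))
      rw [Set.preimage_image_eq]
      · exact hF.isOpen_compl
      · intro ψ ψ' hh
        refine char_eq ψ ψ' ?_
        have h1 : charKer R ψ.1 = charKer R ψ'.1 :=
          congrArg (fun P : PrimSet R => P.1.1) hh
        exact h1.le
    rw [← h] at hU
    obtain ⟨W, hW, hWU⟩ := hU
    have key : ∀ W : Set (ClosedIdeals R), @IsOpen _ (tauW R) W → charKerIdeal R φ ∈ W →
        ∃ a, φ.1 a ≠ 0 ∧ ∀ ψ : Characters R, ψ.1 a ≠ 0 → charKerIdeal R ψ ∈ W := by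
      intro W hW
      induction hW with
      | basic s hs =>
        obtain ⟨J, rfl⟩ := hs
        intro hm
        obtain ⟨a, haJ, ha⟩ := Set.not_subset.1 hm
        exact ⟨a, ha, fun ψ hψ hJ => hψ (hJ haJ)⟩
      | univ =>
        intro _
        obtain ⟨a, ha⟩ := char_exists_ne φ
        exact ⟨a, ha, fun _ _ => trivial⟩
      | inter s t _ _ ihs iht =>
        intro hm
        obtain ⟨a, ha, ha'⟩ := ihs hm.1
        obtain ⟨b, hb, hb'⟩ := iht hm.2
        refine ⟨a * b, ?_, fun ψ hψ => ?_⟩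
        · rw [φ.2.2.2.2.2]; exact mul_ne_zero ha hb
        · rw [ψ.2.2.2.2.2] at hψ
          exact ⟨ha' ψ (left_ne_zero_of_mul hψ), hb' ψ (right_ne_zero_of_mul hψ)⟩
      | sUnion S _ ih =>
        rintro ⟨s, hs, hm⟩
        obtain ⟨a, ha, ha'⟩ := ih s hs hm
        exact ⟨a, ha, fun ψ hψ => ⟨s, hs, ha' ψ hψ⟩⟩
    have hmem : ∀ ψ : Characters R, charKerIdeal R ψ ∈ W ↔ ψ ∉ F := by
      intro ψ
      have : gelfandMap R ψ ∈ Subtype.val ⁻¹' W ↔ gelfandMap R ψ ∈ gelfandMap R '' Fᶜ := by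
        rw [hWU]
      refine this.trans ⟨?_, fun h => ⟨ψ, h, rfl⟩⟩
      rintro ⟨ψ', h1, h2⟩
      have h3 : charKer R ψ'.1 = charKer R ψ.1 := congrArg (fun P : PrimSet R => P.1.1) h2
      rwa [char_eq ψ' ψ h3.le] at h1
    obtain ⟨a, ha, ha'⟩ := key W hW ((hmem φ).2 hφ)
    refine ⟨a, ha, fun ψ hψ => ?_⟩
    by_contra hne
    exact (hmem ψ).1 (ha' ψ hne) hψ
  · intro h
    refine le_antisymm ?_ ?_
    · intro U hU
      have hU' : IsOpen (gelfandMap R ⁻¹' U) := hU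
      refine ⟨{I | ¬ (kerOf (gelfandMap R ⁻¹' U)ᶜ).1 ⊆ I.1},
        TopologicalSpace.isOpen_generateFrom_of_mem ⟨_, rfl⟩, ?_⟩
      ext ⟨P, φ, rfl⟩
      constructor
      · intro hm
        by_contra hP
        exact hm fun a ha => ha φ hP
      · intro hP hsub
        obtain ⟨a, ha, ha'⟩ := h _ hU'.isClosed_compl φ (fun hn => hn hP)
        exact ha (hsub ha')
    · have hc : @Continuous _ _ _ (tauW R) (fun φ => charKerIdeal R φ) := by
        refine continuous_generateFrom_iff.2 ?_
        rintro _ ⟨J, rfl⟩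
        have : (fun φ => charKerIdeal R φ) ⁻¹' {I | ¬ J.1 ⊆ I.1} =
            ⋃ a ∈ J.1, {φ : Characters R | φ.1 a ≠ 0} := by
          ext φ
          simp only [Set.mem_iUnion, Set.mem_preimage, Set.mem_setOf_eq, exists_prop]
          exact Set.not_subset
        rw [this]
        exact isOpen_biUnion fun a _ => isOpen_ne_fun (cont_eval a) continuous_const
      have hc2 : @Continuous _ _ _ (restrictTop R (PrimSet R) (tauW R)) (gelfandMap R) :=
        continuous_induced_rng.2 hc
      exact continuous_iff_coinduced_le.1 hc2

/-! ### Regularity gives local units -/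

theorem local_unit (hreg : Reg R) (L : ClosedIdeals R) (φ : Characters R)
    (hφ : ¬ L.1 ⊆ charKer R φ.1) :
    ∃ e ∈ L.1, ∃ x, φ.1 x = 1 ∧ ∀ ψ : Characters R, ‖ψ.1 x - 1‖ ≤ 1 / 10 → ψ.1 e = 1 := by
  obtain ⟨x₀, hx₀L, hx₀⟩ := Set.not_subset.1 hφ
  obtain ⟨x, hxL, hx1⟩ : ∃ x ∈ L.1, φ.1 x = 1 :=
    ⟨(φ.1 x₀)⁻¹ • x₀, L.2.2.2.2.1 _ _ hx₀L, by
      rw [φ.2.2.2.2.1]; exact inv_mul_cancel₀ hx₀⟩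
  have hsub : ∀ a ∈ L.1, ∀ b ∈ L.1, a - b ∈ L.1 := by
    intro a ha b hb
    have := L.2.2.2.1 a ha _ (L.2.2.2.2.1 (-1) b hb)
    rwa [neg_one_smul, ← sub_eq_add_neg] at this
  let K : Set (Characters R) := {ψ | ‖ψ.1 x - 1‖ ≤ 1 / 10}
  have hK : IsClosed K := isClosed_le ((cont_eval x).sub continuous_const).norm continuous_const
  let d := x - x * x
  have hdL : d ∈ L.1 := hsub _ hxL _ (L.2.2.2.2.2 x hxL x).1
  obtain ⟨Q, _, _, _, π, ha, hs, hm, hn, hk, hsurj, hχ⟩ := quot_exists (kerOf K)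
  have hψd : ∀ ψ : Characters R, ψ.1 d = ψ.1 x * (1 - ψ.1 x) := fun ψ => by
    simp only [d]; rw [char_sub, ψ.2.2.2.2.2]; ring
  have hx9 : ∀ ψ ∈ K, 9 / 10 ≤ ‖ψ.1 x‖ ∧ ‖ψ.1 x‖ ≤ 11 / 10 := by
    intro ψ hψ
    have h1 : ‖ψ.1 x - 1‖ ≤ 1 / 10 := hψ
    have h2 := norm_sub_norm_le (1 : ℂ) (ψ.1 x)
    have h3 := norm_sub_norm_le (ψ.1 x) (1 : ℂ)
    rw [norm_sub_rev] at h2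
    rw [norm_one] at h2 h3
    constructor <;> linarith
  have hbound : ∀ ψ : Characters R, (kerOf K).1 ⊆ charKer R ψ.1 → ‖ψ.1 d‖ ≤ 1 / 8 := by
    intro ψ hψ
    have hψK : ψ ∈ K := by
      by_contra hn
      obtain ⟨a, ha, ha'⟩ := hreg K hK ψ hn
      exact ha (hψ ha')
    have h1 : ‖ψ.1 x - 1‖ ≤ 1 / 10 := hψK
    rw [hψd, norm_mul, norm_sub_rev]
    calc ‖ψ.1 x‖ * ‖ψ.1 x - 1‖ ≤ (11 / 10) * (1 / 10) := by
          gcongr; exact (hx9 ψ hψK).2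
      _ ≤ 1 / 8 := by norm_num
  obtain ⟨c, hc, hc2⟩ := catalan_exists (π d)
    (hom_bound (kerOf K) d (by norm_num) hbound π ha hs hm hn hk)
  obtain ⟨z, b, rfl⟩ := hsurj c
  refine ⟨x + (z • d + d * b), L.2.2.2.1 _ hxL _ (L.2.2.2.1 _ (L.2.2.2.2.1 _ _ hdL) _
    (L.2.2.2.2.2 d hdL b).2), x, hx1, fun ψ hψ => ?_⟩
  have hψK : ψ ∈ K := hψ
  obtain ⟨χ, hχ⟩ := hχ ψ (fun a ha => ha ψ hψK)
  have e1 := congrArg χ hc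
  have e2 := hc2 χ
  have e3 := hbound ψ (fun a ha => ha ψ hψK)
  simp only [map_add, map_mul, map_pow, map_one, hχ, AlgHom.commutes, Algebra.algebraMap_self,
    RingHom.id_apply] at e1 e2
  have e4 := hψd ψ
  rw [ψ.2.2.2.1, ψ.2.2.2.1, ψ.2.2.2.2.1, ψ.2.2.2.2.2]
  have h9 := (hx9 ψ hψK).1
  generalize ψ.1 x = X at *
  generalize ψ.1 d = D at *
  generalize ψ.1 b = β at *
  have hT : ‖z * D + D * β‖ ≤ 1 / 4 := by
    rw [show z * D + D * β = D * (z + β) by ring, norm_mul]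
    calc ‖D‖ * ‖z + β‖ ≤ (1 / 8) * 2 := by gcongr
      _ = 1 / 4 := by norm_num
  have hmul : (X - (z * D + D * β)) * (1 - X - (z * D + D * β)) = 0 := by
    linear_combination (-D) * e1 - e4
  rcases mul_eq_zero.1 hmul with h | h
  · rw [← sub_eq_zero.1 h] at hT; linarith
  · linear_combination -h

theorem unit_on (hreg : Reg R) (L : ClosedIdeals R) (x : R) {s : ℝ} (hs : 0 < s)
    (h : ∀ ψ : Characters R, L.1 ⊆ charKer R ψ.1 → ‖ψ.1 x‖ < s) :
    ∃ e ∈ L.1, ∀ ψ : Characters R, s ≤ ‖ψ.1 x‖ → ψ.1 e = 1 := by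
  have hcpt : IsCompact (XS R ∩ {χ : R → ℂ | s ≤ ‖χ x‖}) :=
    XS_compact.inter_right (isClosed_le continuous_const (continuous_apply x).norm)
  have main : ∃ e ∈ L.1, ∀ ψ : Characters R, ψ.1 ∈ (XS R ∩ {χ : R → ℂ | s ≤ ‖χ x‖}) →
      ψ.1 e = 1 := by
    refine hcpt.induction_on (p := fun S => ∃ e ∈ L.1, ∀ ψ : Characters R, ψ.1 ∈ S → ψ.1 e = 1)
      ⟨0, L.2.2.1, fun ψ h => absurd h (Set.notMem_empty _)⟩ ?_ ?_ ?_
    · rintro S T hST ⟨e, he, h⟩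
      exact ⟨e, he, fun ψ hψ => h ψ (hST hψ)⟩
    · rintro S T ⟨e, he, h⟩ ⟨f, hf, h'⟩
      refine ⟨e + (f + (-1 : ℂ) • (e * f)), L.2.2.2.1 _ he _ (L.2.2.2.1 _ hf _
        (L.2.2.2.2.1 _ _ (L.2.2.2.2.2 _ he f).2)), fun ψ hψ => ?_⟩
      rw [ψ.2.2.2.1, ψ.2.2.2.1, ψ.2.2.2.2.1, ψ.2.2.2.2.2]
      rcases hψ with hψ | hψ
      · rw [h ψ hψ]; ring
      · rw [h' ψ hψ]; ring
    · rintro χ ⟨hχX, hχs⟩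
      have hχs' : s ≤ ‖χ x‖ := hχs
      have h0 : χ ≠ 0 := by
        rintro rfl
        simp at hχs'; linarith
      let φ : Characters R := ⟨χ, XS_char hχX h0⟩
      have hφ : ¬ L.1 ⊆ charKer R φ.1 := fun hh => absurd (h φ hh) (not_lt.2 hχs')
      obtain ⟨e, he, y, hy, hey⟩ := local_unit hreg L φ hφ
      refine ⟨{ψ | ‖ψ y - 1‖ < 1 / 10}, mem_nhdsWithin_of_mem_nhds (IsOpen.mem_nhds ?_ ?_), e, he,
        fun ψ hψ => hey ψ (le_of_lt hψ)⟩
      · exact isOpen_lt ((continuous_apply y).sub continuous_const).norm continuous_const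
      · show ‖χ y - 1‖ < 1 / 10
        have : χ y = 1 := hy
        rw [this]; norm_num
  obtain ⟨e, he, h⟩ := main
  exact ⟨e, he, fun ψ hψ => h ψ ⟨char_XS ψ, hψ⟩⟩

/-! ### Seminorms -/

theorem sk_nonneg {k : ℕ} {ρ : R → ℝ} (h : ρ ∈ SK R k) (a : R) : 0 ≤ ρ a := by
  have hz : ρ 0 = 0 := by simpa using h.2.1 0 0
  have hneg : ρ (-a) = ρ a := by simpa using h.2.1 (-1) a
  have h' := h.1 a (-a)
  rw [add_neg_cancel, hz, hneg] at h'
  linarith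

theorem ker_cont (k : ℕ) : @Continuous _ _ _ (tauInfty R) (kerSK R k) :=
  continuous_iff_coinduced_le.2 (le_iSup (tauK R) k)

theorem open_iff (U : Set (ClosedIdeals R)) :
    @IsOpen _ (tauInfty R) U ↔ ∀ k, IsOpen (kerSK R k ⁻¹' U) := by
  unfold tauInfty
  rw [isOpen_iSup_iff]
  rfl

theorem sk_eval_cont (k : ℕ) (a : R) : Continuous fun ρ : SK R k => ρ.1 a :=
  (continuous_apply a).comp continuous_subtype_val

theorem t2_of_synthesis (hreg : Reg R)
    (hb : ∀ (I : ClosedIdeals R) (a : R),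
      (∀ ψ : Characters R, I.1 ⊆ charKer R ψ.1 → ψ.1 a = 0) → a ∈ I.1) :
    @T2Space (ClosedIdeals R) (tauInfty R) := by
  have hzero : ∀ a : R, (∀ ψ : Characters R, ψ.1 a = 0) → a = 0 := by
    intro a ha
    let Z : ClosedIdeals R := ⟨{0}, isClosed_singleton, rfl, by simp, by simp, by simp⟩
    exact hb Z a fun ψ _ => ha ψ
  -- separation of ideals with different hulls
  have sep : ∀ (I J : ClosedIdeals R) (φ : Characters R), I.1 ⊆ charKer R φ.1 →
      ¬ J.1 ⊆ charKer R φ.1 → ∃ U V : Set (ClosedIdeals R), @IsOpen _ (tauInfty R) U ∧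
        @IsOpen _ (tauInfty R) V ∧ I ∈ U ∧ J ∈ V ∧ Disjoint U V := by
    intro I J φ hI hJ
    obtain ⟨x₀, hx₀J, hx₀⟩ := Set.not_subset.1 hJ
    obtain ⟨x, hxJ, hx2⟩ : ∃ x ∈ J.1, φ.1 x = 2 :=
      ⟨(2 * (φ.1 x₀)⁻¹) • x₀, J.2.2.2.2.1 _ _ hx₀J, by
        rw [φ.2.2.2.2.1, mul_assoc, inv_mul_cancel₀ hx₀, mul_one]⟩
    let U : Set (ClosedIdeals R) := {L | ∃ b, b ∉ L.1 ∧ ∀ ψ : Characters R, ‖ψ.1 x‖ < 1 → ψ.1 b = 0}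
    let V : Set (ClosedIdeals R) := {L | ∃ s, 0 < s ∧ s < 1 ∧
      ∀ ψ : Characters R, L.1 ⊆ charKer R ψ.1 → ‖ψ.1 x‖ < s}
    refine ⟨U, V, ?_, ?_, ?_, ?_, ?_⟩
    · rw [open_iff]
      intro k
      have : kerSK R k ⁻¹' U = ⋃ b ∈ {b : R | ∀ ψ : Characters R, ‖ψ.1 x‖ < 1 → ψ.1 b = 0},
          {ρ : SK R k | ρ.1 b ≠ 0} := by
        ext ρ
        simp only [Set.mem_iUnion, exists_prop, Set.mem_preimage]
        exact ⟨fun ⟨b, h1, h2⟩ => ⟨b, h2, h1⟩, fun ⟨b, h1, h2⟩ => ⟨b, h2, h1⟩⟩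
      rw [this]
      exact isOpen_biUnion fun b _ => isOpen_ne_fun (sk_eval_cont k b) continuous_const
    · rw [open_iff]
      intro k
      rw [isOpen_iff_mem_nhds]
      rintro ρ ⟨s, hs0, hs1, hs⟩
      obtain ⟨e, heL, he⟩ := unit_on hreg _ x hs0 hs
      have heρ : ρ.1 e = 0 := heL
      have hnb : {ρ' : SK R k | ρ'.1 e < 1} ∈ 𝓝 ρ :=
        (isOpen_lt (sk_eval_cont k e) continuous_const).mem_nhds (by
          show ρ.1 e < 1
          rw [heρ]; norm_num)
      refine mem_of_superset hnb fun ρ' hρ' => ?_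
      have hρe : ρ'.1 e < 1 := hρ'
      refine ⟨(s + 1) / 2, by linarith, by linarith, fun ψ hψ => ?_⟩
      by_contra hlt
      have hsx : s < ‖ψ.1 x‖ := by linarith [not_lt.1 hlt]
      obtain ⟨b, hbψ, hb0⟩ := hreg {χ | ‖χ.1 x‖ ≤ s}
        (isClosed_le (cont_eval x).norm continuous_const) ψ (not_le.2 hsx)
      have hbe : b = b * e := by
        rw [← sub_eq_zero]
        refine hzero _ fun χ => ?_
        rw [char_sub, χ.2.2.2.2.2]
        rcases le_total s ‖χ.1 x‖ with h | h
        · rw [he χ h]; ring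
        · rw [hb0 χ h]; ring
      have h1 : ρ'.1 b ≤ ρ'.1 b * ρ'.1 e := by
        conv_lhs => rw [hbe]
        exact ρ'.2.2.2.1 b e
      have h2 := sk_nonneg ρ'.2 b
      have h3 : ρ'.1 b = 0 := by nlinarith
      exact hbψ (hψ h3)
    · obtain ⟨b, hbφ, hb0⟩ := hreg {χ | ‖χ.1 x‖ ≤ 1}
        (isClosed_le (cont_eval x).norm continuous_const) φ (by
          show ¬ ‖φ.1 x‖ ≤ 1
          rw [hx2]; norm_num)
      exact ⟨b, fun h => hbφ (hI h), fun ψ hψ => hb0 ψ hψ.le⟩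
    · refine ⟨1 / 2, by norm_num, by norm_num, fun ψ hψ => ?_⟩
      have : ψ.1 x = 0 := hψ hxJ
      rw [this]; norm_num
    · rw [Set.disjoint_left]
      rintro L ⟨b, hbL, hb'⟩ ⟨s, _, hs1, hs⟩
      exact hbL (hb L b fun ψ hψ => hb' ψ ((hs ψ hψ).trans hs1))
  refine @T2Space.mk _ (tauInfty R) fun I J hIJ => ?_
  by_cases h : ∀ φ : Characters R, I.1 ⊆ charKer R φ.1 ↔ J.1 ⊆ charKer R φ.1
  · exfalso
    refine hIJ (Subtype.ext (Set.Subset.antisymm ?_ ?_))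
    · exact fun a ha => hb J a fun ψ hψ => (h ψ).2 hψ ha
    · exact fun a ha => hb I a fun ψ hψ => (h ψ).1 hψ ha
  · push Not at h
    obtain ⟨φ, ⟨h1, h2⟩ | ⟨h1, h2⟩⟩ := h
    · exact sep I J φ h1 h2
    · obtain ⟨U, V, hU, hV, hJ, hI, hd⟩ := sep J I φ h2 h1
      exact ⟨V, U, hV, hU, hI, hJ, hd.symm⟩

theorem SK_compact : CompactSpace (SK R 1) := by
  rw [← isCompact_iff_compactSpace]
  refine IsCompact.of_isClosed_subset
    (isCompact_univ_pi fun a : R => isCompact_Icc (a := (0 : ℝ)) (b := ‖a‖)) ?_ ?_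
  · have e : SK R 1 = (⋂ x, ⋂ y, {ρ : R → ℝ | ρ (x + y) ≤ ρ x + ρ y}) ∩
        ((⋂ c : ℂ, ⋂ x, {ρ : R → ℝ | ρ (c • x) = ‖c‖ * ρ x}) ∩
        ((⋂ x, ⋂ y, {ρ : R → ℝ | ρ (x * y) ≤ ρ x * ρ y}) ∩
          ⋂ a, {ρ : R → ℝ | ρ a ≤ (1 : ℕ) * ‖a‖})) := by
      ext χ; simp [SK]
    rw [e]
    refine IsClosed.inter (isClosed_iInter fun x => isClosed_iInter fun y =>
        isClosed_le (by fun_prop) (by fun_prop)) (IsClosed.inter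
      (isClosed_iInter fun x => isClosed_iInter fun y => isClosed_eq (by fun_prop) (by fun_prop))
      (IsClosed.inter (isClosed_iInter fun x => isClosed_iInter fun y =>
        isClosed_le (by fun_prop) (by fun_prop))
      (isClosed_iInter fun x => isClosed_le (by fun_prop) (by fun_prop))))
  · intro ρ hρ a _
    exact ⟨sk_nonneg hρ a, by simpa using hρ.2.2.2 a⟩

theorem synthesis_of_t2 (ht : @T2Space (ClosedIdeals R) (tauInfty R)) (I : ClosedIdeals R) (a : R)
    (h : ∀ ψ : Characters R, I.1 ⊆ charKer R ψ.1 → ψ.1 a = 0) : a ∈ I.1 := by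
  have hZ : IsClosed (kerSK R 1 ⁻¹' {I}) := by
    letI := tauInfty R
    exact isClosed_singleton.preimage (ker_cont 1)
  obtain ⟨Q, _, _, _, π, hadd, hs, hm, hn, hk, -, -⟩ := quot_exists I
  have hχ0 : ∀ χ : Q →ₐ[ℂ] ℂ, χ (π a) = 0 := fun χ => by
    have := hom_bound I a le_rfl (fun ψ hψ => by rw [h ψ hψ, norm_zero]) π hadd hs hm hn hk χ
    exact norm_le_zero_iff.1 this
  have hex : ∀ ε > 0, ∃ ρ ∈ kerSK R 1 ⁻¹' {I}, ρ.1 a ≤ ε := by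
    intro ε hε
    obtain ⟨p, h1, h2, h3, h4, h5, h6⟩ := exists_small_norm (π a) hχ0 hε
    refine ⟨⟨fun b => p (π b), ?_, ?_, ?_, ?_⟩, ?_, h5⟩
    · intro b c; simp only [hadd]; exact h1 _ _
    · intro c b; simp only [hs]; exact h2 _ _
    · intro b c; simp only [hm]; exact h3 _ _
    · intro b; simpa using (h4 _).trans (hn b)
    · refine Subtype.ext (Set.ext fun b => ?_)
      show p (π b) = 0 ↔ b ∈ I.1
      rw [← hk]
      refine ⟨h6 _, fun h => ?_⟩
      rw [h]
      simpa using h2 0 0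
  haveI := SK_compact (R := R)
  obtain ⟨ρ₁, hρ₁, -⟩ := hex 1 one_pos
  obtain ⟨ρ, hρ, hmin⟩ := hZ.isCompact.exists_isMinOn ⟨ρ₁, hρ₁⟩ (sk_eval_cont 1 a).continuousOn
  have h0 : ρ.1 a ≤ 0 := le_of_forall_pos_le_add fun ε hε => by
    obtain ⟨ρ', h1, h2⟩ := hex ε hε
    have h3 : ρ.1 a ≤ ρ'.1 a := hmin h1
    linarith
  have h1 : ρ.1 a = 0 := le_antisymm h0 (sk_nonneg ρ.2 a)
  have h2 : kerSK R 1 ρ = I := hρ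
  rw [← h2]
  exact h1

/-! ### Sup seminorms -/

noncomputable def supS (T : Set (R → ℂ)) (a : R) : ℝ := sSup ((fun ψ => ‖ψ a‖) '' T)

theorem supS_bdd {T : Set (R → ℂ)} (hT : T ⊆ XS R) (a : R) :
    BddAbove ((fun ψ : R → ℂ => ‖ψ a‖) '' T) :=
  ⟨‖a‖, by rintro _ ⟨ψ, hψ, rfl⟩; exact (hT hψ).2.2.2 a⟩

theorem le_supS {T : Set (R → ℂ)} (hT : T ⊆ XS R) (a : R) {ψ : R → ℂ} (hψ : ψ ∈ T) :
    ‖ψ a‖ ≤ supS T a := le_csSup (supS_bdd hT a) ⟨ψ, hψ, rfl⟩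

theorem supS_le {T : Set (R → ℂ)} (hne : T.Nonempty) (a : R) {C : ℝ}
    (h : ∀ ψ ∈ T, ‖ψ a‖ ≤ C) : supS T a ≤ C :=
  csSup_le (hne.image _) (by rintro _ ⟨ψ, hψ, rfl⟩; exact h ψ hψ)

theorem supS_nonneg {T : Set (R → ℂ)} (hT : T ⊆ XS R) (hne : T.Nonempty) (a : R) :
    0 ≤ supS T a := by
  obtain ⟨ψ, hψ⟩ := hne
  exact (norm_nonneg _).trans (le_supS hT a hψ)

theorem supS_mem {T : Set (R → ℂ)} (hT : T ⊆ XS R) (hne : T.Nonempty) : supS T ∈ SK R 1 := by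
  have hsm : ∀ (c : ℂ) a, supS T (c • a) ≤ ‖c‖ * supS T a := fun c a =>
    supS_le hne _ fun ψ hψ => by
      rw [(hT hψ).2.1, norm_mul]
      gcongr; exact le_supS hT a hψ
  refine ⟨?_, ?_, ?_, ?_⟩
  · intro a b
    refine supS_le hne _ fun ψ hψ => ?_
    rw [(hT hψ).1]
    exact (norm_add_le _ _).trans (add_le_add (le_supS hT a hψ) (le_supS hT b hψ))
  · intro c x
    refine le_antisymm (hsm c x) ?_
    rcases eq_or_ne c 0 with rfl | hc
    · simpa using supS_nonneg hT hne _
    · have := hsm c⁻¹ (c • x)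
      rw [smul_smul, inv_mul_cancel₀ hc, one_smul, norm_inv] at this
      rwa [← div_eq_inv_mul, le_div_iff₀ (by positivity), mul_comm] at this
  · intro a b
    refine supS_le hne _ fun ψ hψ => ?_
    rw [(hT hψ).2.2.1, norm_mul]
    exact mul_le_mul (le_supS hT a hψ) (le_supS hT b hψ) (norm_nonneg _) (supS_nonneg hT hne a)
  · intro a
    refine supS_le hne _ fun ψ hψ => ?_
    simpa using (hT hψ).2.2.2 a

theorem supS_eq_zero {T : Set (R → ℂ)} (hT : T ⊆ XS R) (hne : T.Nonempty) (a : R) :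
    supS T a = 0 ↔ ∀ ψ ∈ T, ψ a = 0 := by
  constructor
  · intro h ψ hψ
    exact norm_le_zero_iff.1 (h ▸ le_supS hT a hψ)
  · intro h
    exact le_antisymm (supS_le hne a fun ψ hψ => by rw [h ψ hψ, norm_zero])
      (supS_nonneg hT hne a)

theorem supS_tendsto {G : Set (R → ℂ)} (hG : G ⊆ XS R) {χ : R → ℂ} (hχ : χ ∈ G)
    (F : Set (R → ℂ)) :
    Tendsto (fun t : Set (R → ℂ) => supS (G ∪ (t ∩ XS R))) (𝓝[F] χ).smallSets (𝓝 (supS G)) := by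
  rw [tendsto_pi_nhds]
  intro a
  have hsub : ∀ t : Set (R → ℂ), G ∪ (t ∩ XS R) ⊆ XS R := fun t =>
    Set.union_subset hG Set.inter_subset_right
  have hlow : ∀ t : Set (R → ℂ), supS G a ≤ supS (G ∪ (t ∩ XS R)) a := fun t =>
    supS_le ⟨χ, hχ⟩ a fun ψ hψ => le_supS (hsub t) a (Or.inl hψ)
  rw [Metric.tendsto_nhds]
  intro ε hε
  have hnb : {ψ : R → ℂ | ‖ψ a‖ < ‖χ a‖ + ε / 2} ∈ 𝓝[F] χ :=
    mem_nhdsWithin_of_mem_nhds ((isOpen_lt (continuous_apply a).norm continuous_const).mem_nhds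
      (by show ‖χ a‖ < ‖χ a‖ + ε / 2; linarith))
  refine eventually_smallSets.2 ⟨_, hnb, fun t ht => ?_⟩
  have hup : supS (G ∪ (t ∩ XS R)) a ≤ supS G a + ε / 2 := by
    refine supS_le ⟨χ, Or.inl hχ⟩ a ?_
    rintro ψ (hψ | hψ)
    · have := le_supS hG a hψ
      linarith
    · have h1 : ‖ψ a‖ < ‖χ a‖ + ε / 2 := ht hψ.1
      have h2 := le_supS hG a hχ
      linarith
  rw [Real.dist_eq, abs_of_nonneg (by linarith [hlow t])]
  linarith

theorem reg_of_t2 (ht : @T2Space (ClosedIdeals R) (tauInfty R)) : Reg R := by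
  intro F hF φ hφ
  obtain ⟨C, hC, rfl⟩ := isClosed_induced_iff.1 hF
  let F' : Set (R → ℂ) := XS R ∩ (C ∪ {0})
  have hF' : IsCompact F' := XS_compact.inter_right (hC.union isClosed_singleton)
  have main : ∃ a, φ.1 a ≠ 0 ∧ ∀ ψ ∈ F', ψ a = 0 := by
    refine hF'.induction_on (p := fun S => ∃ a, φ.1 a ≠ 0 ∧ ∀ ψ ∈ S, ψ a = 0 ∨ ψ ∉ XS R) ?_ ?_ ?_ ?_
      |>.imp fun a h => ⟨h.1, fun ψ hψ => (h.2 ψ hψ).resolve_right (fun hn => hn hψ.1)⟩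
    · obtain ⟨a, ha⟩ := char_exists_ne φ
      exact ⟨a, ha, fun ψ h => absurd h (Set.notMem_empty _)⟩
    · rintro S T hST ⟨a, ha, h⟩
      exact ⟨a, ha, fun ψ hψ => h ψ (hST hψ)⟩
    · rintro S T ⟨a, ha, h⟩ ⟨b, hb, h'⟩
      refine ⟨a * b, by rw [φ.2.2.2.2.2]; exact mul_ne_zero ha hb, fun ψ hψ => ?_⟩
      by_cases hX : ψ ∈ XS R
      · left
        rw [hX.2.2.1]
        rcases hψ with hψ | hψ
        · rw [(h ψ hψ).resolve_right (fun hn => hn hX), zero_mul]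
        · rw [(h' ψ hψ).resolve_right (fun hn => hn hX), mul_zero]
      · exact Or.inr hX
    · intro χ hχ
      by_contra hcon
      push Not at hcon
      have hG1 : ({χ} : Set (R → ℂ)) ⊆ XS R := by rintro _ rfl; exact hχ.1
      have hG2 : ({φ.1, χ} : Set (R → ℂ)) ⊆ XS R := by
        rintro _ (rfl | rfl)
        · exact char_XS φ
        · exact hχ.1
      have hs1 : ∀ t : Set (R → ℂ), {χ} ∪ (t ∩ XS R) ⊆ XS R := fun t =>
        Set.union_subset hG1 Set.inter_subset_right
      have hs2 : ∀ t : Set (R → ℂ), {φ.1, χ} ∪ (t ∩ XS R) ⊆ XS R := fun t =>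
        Set.union_subset hG2 Set.inter_subset_right
      have hn1 : ∀ t : Set (R → ℂ), ({χ} ∪ (t ∩ XS R)).Nonempty := fun t => ⟨χ, Or.inl rfl⟩
      have hn2 : ∀ t : Set (R → ℂ), ({φ.1, χ} ∪ (t ∩ XS R)).Nonempty := fun t =>
        ⟨χ, Or.inl (Or.inr rfl)⟩
      let σ : Set (R → ℂ) → SK R 1 := fun t => ⟨_, supS_mem (hs1 t) (hn1 t)⟩
      let μ : Set (R → ℂ) → SK R 1 := fun t => ⟨_, supS_mem (hs2 t) (hn2 t)⟩
      let σ₀ : SK R 1 := ⟨_, supS_mem hG1 ⟨χ, rfl⟩⟩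
      let μ₀ : SK R 1 := ⟨_, supS_mem hG2 ⟨χ, Or.inr rfl⟩⟩
      have hσ : Tendsto σ (𝓝[F'] χ).smallSets (𝓝 σ₀) :=
        tendsto_subtype_rng.2 (supS_tendsto hG1 rfl F')
      have hμ : Tendsto μ (𝓝[F'] χ).smallSets (𝓝 μ₀) :=
        tendsto_subtype_rng.2 (supS_tendsto hG2 (Or.inr rfl) F')
      have hne : kerSK R 1 σ₀ ≠ kerSK R 1 μ₀ := by
        intro he
        have hsub : ∀ a, χ a = 0 → φ.1 a = 0 := by
          intro a ha
          have h1 : a ∈ (kerSK R 1 σ₀).1 :=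
            (supS_eq_zero hG1 ⟨χ, rfl⟩ a).2 (by rintro _ rfl; exact ha)
          rw [he] at h1
          exact (supS_eq_zero hG2 ⟨χ, Or.inr rfl⟩ a).1 h1 φ.1 (Or.inl rfl)
        by_cases h0 : χ = 0
        · obtain ⟨a, ha⟩ := char_exists_ne φ
          exact ha (hsub a (by rw [h0]; rfl))
        · have := char_eq ⟨χ, XS_char hχ.1 h0⟩ φ (fun a ha => hsub a ha)
          have h2 : χ ∈ C := hχ.2.resolve_right h0
          apply hφ
          rw [← this]
          exact h2
      letI := tauInfty R
      obtain ⟨U, V, hU, hV, hIU, hJV, hd⟩ := t2_separation hne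
      have e1 : ∀ᶠ t in (𝓝[F'] χ).smallSets, kerSK R 1 (σ t) ∈ U :=
        hσ (((ker_cont 1).isOpen_preimage U hU).mem_nhds hIU)
      have e2 : ∀ᶠ t in (𝓝[F'] χ).smallSets, kerSK R 1 (μ t) ∈ V :=
        hμ (((ker_cont 1).isOpen_preimage V hV).mem_nhds hJV)
      obtain ⟨s, hs, hst⟩ := eventually_smallSets.1 (e1.and e2)
      obtain ⟨h1, h2⟩ := hst (s ∩ F') Set.inter_subset_left
      have hmem : s ∩ F' ∈ 𝓝[F'] χ := inter_mem hs self_mem_nhdsWithin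
      have hker : kerSK R 1 (σ (s ∩ F')) = kerSK R 1 (μ (s ∩ F')) := by
        refine Subtype.ext (Set.ext fun a => ?_)
        refine (supS_eq_zero (hs1 _) (hn1 _) a).trans
          (Iff.trans ?_ (supS_eq_zero (hs2 _) (hn2 _) a).symm)
        constructor
        · intro h
          have hφa : φ.1 a = 0 := by
            by_contra hne0
            obtain ⟨ψ, hψ, hψa, -⟩ := hcon _ hmem a hne0
            exact hψa (h ψ (Or.inr ⟨hψ, hψ.2.1⟩))
          rintro ψ ((rfl | rfl) | hψ)
          · exact hφa
          · exact h _ (Or.inl rfl)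
          · exact h _ (Or.inr hψ)
        · rintro h ψ (rfl | hψ)
          · exact h _ (Or.inl (Or.inr rfl))
          · exact h _ (Or.inr hψ)
      have h1' : kerSK R 1 (σ (s ∩ F')) ∈ U := h1
      have h2' : kerSK R 1 (μ (s ∩ F')) ∈ V := h2
      rw [← hker] at h2'
      exact Set.disjoint_left.1 hd h1' h2'
  obtain ⟨a, ha, h⟩ := main
  exact ⟨a, ha, fun ψ hψ => h ψ.1 ⟨char_XS ψ, Or.inl hψ⟩⟩

theorem main_comm :
    @T2Space (ClosedIdeals R) (tauInfty R) ↔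
      (restrictTop R (PrimSet R) (tauW R) = gelfandTop R ∧
        ∀ I : ClosedIdeals R, I.1 ≠ Set.univ →
          I.1 = ⋂ (φ : Characters R), ⋂ (_ : I.1 ⊆ charKer R φ.1), charKer R φ.1) := by
  constructor
  · intro h
    refine ⟨reg_iff.2 (reg_of_t2 h), fun I _ => Set.Subset.antisymm ?_ ?_⟩
    · exact Set.subset_iInter fun φ => Set.subset_iInter fun hφ => hφ
    · intro a ha
      refine synthesis_of_t2 h I a fun ψ hψ => ?_
      exact Set.mem_iInter₂.1 ha ψ hψ
  · rintro ⟨h1, h2⟩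
    refine t2_of_synthesis (reg_iff.1 h1) fun I a ha => ?_
    by_cases hI : I.1 = Set.univ
    · rw [hI]; trivial
    · rw [h2 I hI]
      exact Set.mem_iInter₂.2 fun ψ hψ => ha ψ hψ

end R
end SSX

/-- Theorem 1.8 of the paper: for a commutative Banach algebra `A`, the topology
`τ_∞` is Hausdorff on `Id(A)` if and only if `A` has spectral synthesis in the
usual sense, namely the hull-kernel topology coincides with the Gelfand topology
on `Prim(A)` and every proper closed ideal of `A` is an intersection of kernels
of characters. -/
theorem tauInfty_t2_iff_spectral_synthesis
    (hcomm : ∀ x y : A, x * y = y * x) :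
    @T2Space (ClosedIdeals A) (tauInfty A) ↔
      (restrictTop A (PrimSet A) (tauW A) = gelfandTop A ∧
        ∀ I : ClosedIdeals A, I.1 ≠ Set.univ →
          I.1 = ⋂ (φ : Characters A), ⋂ (_ : I.1 ⊆ charKer A φ.1), charKer A φ.1) := by
  let inst : NonUnitalNormedCommRing A :=
    { (inferInstance : NonUnitalNormedRing A) with mul_comm := hcomm }
  exact @SSX.main_comm A inst _ _ _ _

end BanachAlgebraPrelude
end

section
/- Let A be a Banach algebra over ℂ such that the topology τ_∞ is Hausdorff on Id(A). Then A has weak spectral synthesis, that is: (i) Prime(A) is locally compact in the hull-kernel topology; (ii) the hull-kernel topology has the normality property on Prime(A); and (iii) every proper closed two-sided ideal of A equals the intersection of the closed prime two-sided ideals containing it. -/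
set_option linter.unusedSectionVars false

open Filter Topology

section BanachAlgebraPrelude

variable (A : Type*) [NonUnitalNormedRing A] [NormedSpace ℂ A]
  [IsScalarTower ℂ A A] [SMulCommClass ℂ A A] [CompleteSpace A]

/-! ### Abstract lattice part -/

/-- The way-below relation. -/
def WayB {L : Type*} [CompleteLattice L] (w x : L) : Prop :=
  ∀ D : Set L, D.Nonempty → DirectedOn (· ≤ ·) D → x ≤ sSup D → ∃ d ∈ D, w ≤ d

/-- Continuity of a complete lattice. -/
def ContLat (L : Type*) [CompleteLattice L] : Prop :=
  ∀ x y : L, ¬ x ≤ y → ∃ w, WayB w x ∧ ¬ w ≤ y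

/-- Scott-open filters (possibly empty). -/
structure OpenFilt {L : Type*} [CompleteLattice L] (F : Set L) : Prop where
  up : ∀ x y, x ∈ F → x ≤ y → y ∈ F
  inf : ∀ x y, x ∈ F → y ∈ F → x ⊓ y ∈ F
  scott : ∀ D : Set L, D.Nonempty → DirectedOn (· ≤ ·) D → sSup D ∈ F → ∃ d ∈ D, d ∈ F

/-- Prime elements of a lattice. -/
def PrimeElt {L : Type*} [CompleteLattice L] (p : L) : Prop :=
  p ≠ ⊤ ∧ ∀ a b, a ⊓ b ≤ p → a ≤ p ∨ b ≤ p

theorem WayB.mono {L : Type*} [CompleteLattice L] {a b c d : L} (h : WayB b c) (hab : a ≤ b)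
    (hcd : c ≤ d) : WayB a d := by
  intro D h1 h2 h3
  obtain ⟨e, he, hbe⟩ := h D h1 h2 (hcd.trans h3)
  exact ⟨e, he, hab.trans hbe⟩

theorem WayB.le {L : Type*} [CompleteLattice L] {a b : L} (h : WayB a b) : a ≤ b := by
  obtain ⟨d, hd, had⟩ := h {b} ⟨b, rfl⟩ (by
    intro x hx y hy
    refine ⟨b, rfl, ?_, ?_⟩
    · exact le_of_eq hx
    · exact le_of_eq hy) (by simp)
  rw [Set.mem_singleton_iff] at hd
  rwa [← hd]

theorem WayB.sup {L : Type*} [CompleteLattice L] {a b c : L} (h : WayB a c) (h' : WayB b c) :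
    WayB (a ⊔ b) c := by
  intro D h1 h2 h3
  obtain ⟨d, hd, had⟩ := h D h1 h2 h3
  obtain ⟨e, he, hbe⟩ := h' D h1 h2 h3
  obtain ⟨f, hf, hdf, hef⟩ := h2 d hd e he
  exact ⟨f, hf, sup_le (had.trans hdf) (hbe.trans hef)⟩

theorem wayB_bot {L : Type*} [CompleteLattice L] (c : L) : WayB ⊥ c := by
  rintro D ⟨d, hd⟩ - -
  exact ⟨d, hd, bot_le⟩

theorem wayB_interp {L : Type*} [CompleteLattice L] (hL : ContLat L) {x y : L} (h : WayB x y) :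
    ∃ z, WayB x z ∧ WayB z y := by
  obtain ⟨w, ⟨z, hwz, hzy⟩, hxw⟩ := h {w | ∃ z, WayB w z ∧ WayB z y}
    ⟨⊥, ⊥, wayB_bot _, wayB_bot _⟩
    (by
      rintro w1 ⟨z1, h1, h1'⟩ w2 ⟨z2, h2, h2'⟩
      exact ⟨w1 ⊔ w2, ⟨z1 ⊔ z2, (h1.mono le_rfl le_sup_left).sup (h2.mono le_rfl le_sup_right),
        h1'.sup h2'⟩, le_sup_left, le_sup_right⟩)
    (by
      by_contra hc
      obtain ⟨z, hz, hz'⟩ := hL _ _ hc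
      obtain ⟨w, hw, hw'⟩ := hL _ _ hz'
      exact hw' (le_sSup ⟨z, hw, hz⟩))
  exact ⟨z, hwz.mono hxw le_rfl, hzy⟩

theorem exists_openFilt {L : Type*} [CompleteLattice L] (hL : ContLat L) {x y : L}
    (h : WayB x y) : ∃ F : Set L, OpenFilt F ∧ y ∈ F ∧ ∀ k ∈ F, x ≤ k := by
  have step : ∀ z : {z : L // WayB x z}, ∃ z' : {z : L // WayB x z}, WayB z'.1 z.1 := by
    rintro ⟨z, hz⟩
    obtain ⟨z', h1, h2⟩ := wayB_interp hL hz
    exact ⟨⟨z', h1⟩, h2⟩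
  choose g hg using step
  let s : ℕ → {z : L // WayB x z} := fun n => Nat.rec ⟨y, h⟩ (fun _ z => g z) n
  have hs : ∀ n, WayB (s (n + 1)).1 (s n).1 := fun n => hg (s n)
  have hanti : Antitone (fun n => (s n).1) := antitone_nat_of_succ_le (fun n => (hs n).le)
  refine ⟨{k | ∃ n, (s n).1 ≤ k}, ⟨?_, ?_, ?_⟩, ⟨0, le_rfl⟩, ?_⟩
  · rintro a b ⟨n, hn⟩ hab
    exact ⟨n, hn.trans hab⟩
  · rintro a b ⟨n, hn⟩ ⟨m, hm⟩
    exact ⟨max n m, le_inf ((hanti (le_max_left n m)).trans hn)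
      ((hanti (le_max_right n m)).trans hm)⟩
  · rintro D h1 h2 ⟨n, hn⟩
    obtain ⟨d, hd, hnd⟩ := hs n D h1 h2 hn
    exact ⟨d, hd, n + 1, hnd⟩
  · rintro k ⟨n, hn⟩
    exact (s n).2.le.trans hn

theorem exists_prime_notMem {L : Type*} [CompleteLattice L]
    (hdist : ∀ a b c : L, (a ⊔ b) ⊓ (a ⊔ c) ≤ a ⊔ (b ⊓ c)) {F : Set L} (hF : OpenFilt F)
    (hne : F.Nonempty) {y : L} (hy : y ∉ F) : ∃ p, PrimeElt p ∧ y ≤ p ∧ p ∉ F := by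
  obtain ⟨p, hyp, hp⟩ := zorn_le_nonempty₀ (Fᶜ) (by
    intro c hc hch z hz
    refine ⟨sSup c, ?_, fun w hw => le_sSup hw⟩
    intro hmem
    obtain ⟨d, hd, hdF⟩ := hF.scott c ⟨z, hz⟩ hch.directedOn hmem
    exact hc hd hdF) y hy
  have hpF : p ∉ F := hp.prop
  have key : ∀ a, ¬ a ≤ p → p ⊔ a ∈ F := by
    intro a ha
    by_contra hcon
    exact ha (le_sup_right.trans (hp.le_of_ge hcon le_sup_left))
  refine ⟨p, ⟨?_, ?_⟩, hyp, hpF⟩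
  · rintro rfl
    obtain ⟨k, hk⟩ := hne
    exact hpF (hF.up _ _ hk le_top)
  · intro a b hab
    by_contra! hcon
    have h1 := hF.inf _ _ (key a hcon.1) (key b hcon.2)
    exact hpF (hF.up _ _ h1 ((hdist _ _ _).trans (sup_le le_rfl hab)))

/-- The lower topology on a lattice. -/
def lowTop (L : Type*) [CompleteLattice L] : TopologicalSpace L :=
  TopologicalSpace.generateFrom {U | ∃ j : L, U = {i | ¬ j ≤ i}}

theorem lowTop_basis {L : Type*} [CompleteLattice L] {U : Set L}
    (hU : IsOpen[lowTop L] U) : ∀ p, PrimeElt p → p ∈ U →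
      ∃ j, ¬ j ≤ p ∧ ∀ q, PrimeElt q → ¬ j ≤ q → q ∈ U := by
  have hU' : TopologicalSpace.GenerateOpen {U | ∃ j : L, U = {i | ¬ j ≤ i}} U := hU
  clear hU
  induction hU' with
  | basic s hs =>
    obtain ⟨j, rfl⟩ := hs
    intro p _ hpj
    exact ⟨j, hpj, fun q _ hq => hq⟩
  | univ =>
    intro p hp _
    exact ⟨⊤, fun h => hp.1 (top_le_iff.1 h), fun _ _ _ => trivial⟩
  | inter s t _ _ ih1 ih2 =>
    rintro p hp ⟨h1, h2⟩
    obtain ⟨j1, hj1, hj1'⟩ := ih1 p hp h1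
    obtain ⟨j2, hj2, hj2'⟩ := ih2 p hp h2
    refine ⟨j1 ⊓ j2, fun h => (hp.2 _ _ h).elim hj1 hj2, fun q hq hqj => ⟨?_, ?_⟩⟩
    · exact hj1' q hq fun h => hqj (inf_le_left.trans h)
    · exact hj2' q hq fun h => hqj (inf_le_right.trans h)
  | sUnion S _ ih =>
    rintro p hp ⟨s, hs, hps⟩
    obtain ⟨j, hj, hj'⟩ := ih s hs p hp hps
    exact ⟨j, hj, fun q hq hqj => ⟨s, hs, hj' q hq hqj⟩⟩

theorem isCompact_compl_filt {L : Type*} [CompleteLattice L]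
    (hdist : ∀ a b c : L, (a ⊔ b) ⊓ (a ⊔ c) ≤ a ⊔ (b ⊓ c)) {F : Set L} (hF : OpenFilt F)
    (hne : F.Nonempty) : @IsCompact L (lowTop L) {p | PrimeElt p ∧ p ∉ F} := by
  letI := lowTop L
  refine isCompact_generateFrom (S := {U | ∃ j : L, U = {i | ¬ j ≤ i}}) rfl ?_
  intro P hP hcov
  -- the ideals generating the cover
  let J : Set L := {j | {i | ¬ j ≤ i} ∈ P}
  let D : Set L := {d | ∃ t : Finset L, (↑t : Set L) ⊆ J ∧ d = t.sup id}
  have hD : sSup D ∈ F := by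
    by_contra hcon
    obtain ⟨p, hp, hyp, hpF⟩ := exists_prime_notMem hdist hF hne hcon
    obtain ⟨U, hU, hpU⟩ := hcov ⟨hp, hpF⟩
    obtain ⟨j, rfl⟩ := hP hU
    refine hpU (le_trans (le_sSup ?_) hyp)
    exact ⟨{j}, by simpa [J] using hU, by simp⟩
  classical
  obtain ⟨d, ⟨t, ht, rfl⟩, hdF⟩ := hF.scott D ⟨⊥, ∅, by simp, by simp⟩ (by
    rintro _ ⟨t, ht, rfl⟩ _ ⟨u, hu, rfl⟩
    refine ⟨(t ∪ u).sup id, ⟨t ∪ u, ?_, rfl⟩, ?_, ?_⟩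
    · rw [Finset.coe_union]
      exact Set.union_subset ht hu
    · exact Finset.sup_mono Finset.subset_union_left
    · exact Finset.sup_mono Finset.subset_union_right) hD
  refine ⟨(fun j => {i | ¬ j ≤ i}) '' (↑t : Set L), ?_, t.finite_toSet.image _, ?_⟩
  · rintro _ ⟨j, hj, rfl⟩
    exact ht hj
  · rintro p ⟨hp, hpF⟩
    by_contra hcon
    refine hpF (hF.up _ _ hdF (Finset.sup_le ?_))
    intro j hj
    by_contra hjp
    exact hcon ⟨_, ⟨j, hj, rfl⟩, hjp⟩

theorem locallyCompact_primes {L : Type*} [CompleteLattice L] (hL : ContLat L)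
    (hdist : ∀ a b c : L, (a ⊔ b) ⊓ (a ⊔ c) ≤ a ⊔ (b ⊓ c)) (X : Set L)
    (hX : ∀ p, p ∈ X ↔ PrimeElt p) :
    @LocallyCompactSpace X (TopologicalSpace.induced Subtype.val (lowTop L)) := by
  letI : TopologicalSpace L := lowTop L
  refine ⟨fun p N hN => ?_⟩
  rw [mem_nhds_induced] at hN
  obtain ⟨V, hV, hVN⟩ := hN
  obtain ⟨U, hUV, hU, hpU⟩ := mem_nhds_iff.1 hV
  obtain ⟨j, hj, hj'⟩ := lowTop_basis hU p.1 ((hX _).1 p.2) hpU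
  obtain ⟨x, hxj, hxp⟩ := hL _ _ hj
  obtain ⟨F, hF, hjF, hxF⟩ := exists_openFilt hL hxj
  refine ⟨{q | q.1 ∉ F}, ?_, ?_, ?_⟩
  · rw [mem_nhds_induced]
    refine ⟨{i | ¬ x ≤ i}, ?_, ?_⟩
    · exact IsOpen.mem_nhds (TopologicalSpace.isOpen_generateFrom_of_mem ⟨x, rfl⟩) hxp
    · intro q hq hqF
      exact hq (hxF _ hqF)
  · intro q hq
    refine hVN (hUV (hj' q.1 ((hX _).1 q.2) ?_))
    exact fun h => hq (hF.up _ _ hjF h)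
  · rw [Topology.IsInducing.subtypeVal.isCompact_iff]
    convert isCompact_compl_filt hdist hF ⟨j, hjF⟩ using 1
    ext q
    constructor
    · rintro ⟨q, hq, rfl⟩
      exact ⟨(hX _).1 q.2, hq⟩
    · rintro ⟨h1, h2⟩
      exact ⟨⟨q, (hX _).2 h1⟩, h2, rfl⟩

/-! ### Quotient norms -/

section QN

variable {A}

theorem qn_nonneg (I : ClosedIdeals A) (a : A) : 0 ≤ qnorm A a I.1 := Metric.infDist_nonneg

theorem qn_lt {I : ClosedIdeals A} {a : A} {r : ℝ} :
    qnorm A a I.1 < r ↔ ∃ m ∈ I.1, ‖a - m‖ < r := by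
  unfold qnorm
  rw [Metric.infDist_lt_iff ⟨0, I.2.2.1⟩]
  simp only [dist_eq_norm]

theorem qn_le {I : ClosedIdeals A} {a m : A} (hm : m ∈ I.1) : qnorm A a I.1 ≤ ‖a - m‖ := by
  have := Metric.infDist_le_dist_of_mem (x := a) hm
  rwa [dist_eq_norm] at this

theorem qn_le_norm (I : ClosedIdeals A) (a : A) : qnorm A a I.1 ≤ ‖a‖ := by
  simpa using qn_le (a := a) I.2.2.1

theorem qn_zero_iff {I : ClosedIdeals A} {a : A} : qnorm A a I.1 = 0 ↔ a ∈ I.1 :=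
  (I.2.1.mem_iff_infDist_zero ⟨0, I.2.2.1⟩).symm

theorem qn_anti {I J : ClosedIdeals A} (h : I ≤ J) (a : A) : qnorm A a J.1 ≤ qnorm A a I.1 :=
  Metric.infDist_le_infDist_of_subset h ⟨0, I.2.2.1⟩

theorem id_neg (I : ClosedIdeals A) {a : A} (h : a ∈ I.1) : -a ∈ I.1 := by
  simpa using I.2.2.2.2.1 (-1) a h

theorem id_add (I : ClosedIdeals A) {a b : A} (h : a ∈ I.1) (h' : b ∈ I.1) : a + b ∈ I.1 :=
  I.2.2.2.1 a h b h'

theorem id_mul_left (I : ClosedIdeals A) {a : A} (b : A) (h : a ∈ I.1) : b * a ∈ I.1 :=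
  (I.2.2.2.2.2 a h b).1

theorem id_mul_right (I : ClosedIdeals A) {a : A} (b : A) (h : a ∈ I.1) : a * b ∈ I.1 :=
  (I.2.2.2.2.2 a h b).2

theorem qn_add (I : ClosedIdeals A) (a b : A) :
    qnorm A (a + b) I.1 ≤ qnorm A a I.1 + qnorm A b I.1 := by
  refine le_of_forall_pos_le_add fun δ hδ => ?_
  obtain ⟨m, hm, hm'⟩ := qn_lt.1 (lt_add_of_pos_right (qnorm A a I.1) (half_pos hδ))
  obtain ⟨n, hn, hn'⟩ := qn_lt.1 (lt_add_of_pos_right (qnorm A b I.1) (half_pos hδ))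
  have h1 := qn_le (a := a + b) (id_add I hm hn)
  have h2 := norm_add_le (a - m) (b - n)
  rw [show a - m + (b - n) = a + b - (m + n) by abel] at h2
  linarith

theorem qn_smul_le (I : ClosedIdeals A) (c : ℂ) (a : A) :
    qnorm A (c • a) I.1 ≤ ‖c‖ * qnorm A a I.1 := by
  have key : ∀ δ > 0, qnorm A (c • a) I.1 ≤ ‖c‖ * (qnorm A a I.1 + δ) := by
    intro δ hδ
    obtain ⟨m, hm, hm'⟩ := qn_lt.1 (lt_add_of_pos_right (qnorm A a I.1) hδ)
    have h1 := qn_le (a := c • a) (I.2.2.2.2.1 c m hm)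
    rw [← smul_sub, norm_smul] at h1
    exact h1.trans (by gcongr)
  have ht : Tendsto (fun δ : ℝ => ‖c‖ * (qnorm A a I.1 + δ)) (𝓝[>] 0)
      (𝓝 (‖c‖ * (qnorm A a I.1 + 0))) := by
    apply tendsto_nhdsWithin_of_tendsto_nhds
    exact Continuous.tendsto (by fun_prop) 0
  rw [add_zero] at ht
  exact ge_of_tendsto ht (eventually_nhdsWithin_of_forall key)

theorem qn_smul (I : ClosedIdeals A) (c : ℂ) (a : A) :
    qnorm A (c • a) I.1 = ‖c‖ * qnorm A a I.1 := by
  refine le_antisymm (qn_smul_le I c a) ?_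
  rcases eq_or_ne c 0 with rfl | hc
  · simpa using qn_nonneg I _
  · have h1 := qn_smul_le I c⁻¹ (c • a)
    rw [smul_smul, inv_mul_cancel₀ hc, one_smul, norm_inv] at h1
    have h2 : 0 < ‖c‖ := norm_pos_iff.2 hc
    rw [inv_mul_eq_div, le_div_iff₀ h2] at h1
    linarith

theorem qn_mul (I : ClosedIdeals A) (a b : A) :
    qnorm A (a * b) I.1 ≤ qnorm A a I.1 * qnorm A b I.1 := by
  have key : ∀ δ > 0, qnorm A (a * b) I.1 ≤ (qnorm A a I.1 + δ) * (qnorm A b I.1 + δ) := by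
    intro δ hδ
    obtain ⟨m, hm, hm'⟩ := qn_lt.1 (lt_add_of_pos_right (qnorm A a I.1) hδ)
    obtain ⟨n, hn, hn'⟩ := qn_lt.1 (lt_add_of_pos_right (qnorm A b I.1) hδ)
    have h1 := qn_le (a := a * b) (id_add I (id_mul_right I b hm) (id_mul_left I (a - m) hn))
    rw [show a * b - (m * b + (a - m) * n) = (a - m) * (b - n) by noncomm_ring] at h1
    refine h1.trans ((norm_mul_le _ _).trans ?_)
    exact mul_le_mul hm'.le hn'.le (norm_nonneg _) (by linarith [qn_nonneg I a])
  have ht : Tendsto (fun δ : ℝ => (qnorm A a I.1 + δ) * (qnorm A b I.1 + δ)) (𝓝[>] 0)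
      (𝓝 ((qnorm A a I.1 + 0) * (qnorm A b I.1 + 0))) := by
    apply tendsto_nhdsWithin_of_tendsto_nhds
    exact Continuous.tendsto (by fun_prop) 0
  rw [add_zero, add_zero] at ht
  exact ge_of_tendsto ht (eventually_nhdsWithin_of_forall key)

theorem qn_mem_SK (I : ClosedIdeals A) : (fun a => qnorm A a I.1) ∈ SK A 1 :=
  ⟨qn_add I, qn_smul I, qn_mul I, fun a => by simpa using qn_le_norm I a⟩

/-- Key estimate when `K² ⊆ J ⊆ K`. -/
theorem qn_mul_sq {J K : ClosedIdeals A} (hKK : ∀ x ∈ K.1, ∀ y ∈ K.1, x * y ∈ J.1) (a b : A) :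
    qnorm A (a * b) J.1 ≤ qnorm A a K.1 * qnorm A b J.1 + qnorm A a J.1 * qnorm A b K.1
      + qnorm A a K.1 * qnorm A b K.1 := by
  have key : ∀ δ > 0, qnorm A (a * b) J.1 ≤ (qnorm A a K.1 + δ) * qnorm A b J.1
      + (qnorm A a J.1 + (qnorm A a K.1 + δ)) * (qnorm A b K.1 + δ) := by
    intro δ hδ
    obtain ⟨m, hm, hm'⟩ := qn_lt.1 (lt_add_of_pos_right (qnorm A a K.1) hδ)
    obtain ⟨n, hn, hn'⟩ := qn_lt.1 (lt_add_of_pos_right (qnorm A b K.1) hδ)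
    have e1 := qn_add J ((a - m) * b) (m * (b - n) + m * n)
    have e2 := qn_add J (m * (b - n)) (m * n)
    rw [show (a - m) * b + (m * (b - n) + m * n) = a * b by noncomm_ring] at e1
    rw [qn_zero_iff.2 (hKK m hm n hn)] at e2
    have e3 := qn_mul J (a - m) b
    have e4 := qn_mul J m (b - n)
    have e5 := qn_le_norm J (a - m)
    have e6 := qn_le_norm J (b - n)
    have e7 := qn_add J a (-(a - m))
    have e8 : qnorm A (-(a - m)) J.1 = qnorm A (a - m) J.1 := by
      simpa using qn_smul J (-1) (a - m)
    rw [show a + -(a - m) = m by abel, e8] at e7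
    have e9 : qnorm A (a - m) J.1 * qnorm A b J.1 ≤ (qnorm A a K.1 + δ) * qnorm A b J.1 :=
      mul_le_mul_of_nonneg_right (by linarith) (qn_nonneg _ _)
    have e10 : qnorm A m J.1 * qnorm A (b - n) J.1 ≤
        (qnorm A a J.1 + (qnorm A a K.1 + δ)) * (qnorm A b K.1 + δ) :=
      mul_le_mul (by linarith) (by linarith) (qn_nonneg _ _)
        (by linarith [qn_nonneg J a, qn_nonneg K a])
    linarith
  have ht : Tendsto (fun δ : ℝ => (qnorm A a K.1 + δ) * qnorm A b J.1
      + (qnorm A a J.1 + (qnorm A a K.1 + δ)) * (qnorm A b K.1 + δ)) (𝓝[>] 0)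
      (𝓝 ((qnorm A a K.1 + 0) * qnorm A b J.1
      + (qnorm A a J.1 + (qnorm A a K.1 + 0)) * (qnorm A b K.1 + 0))) := by
    apply tendsto_nhdsWithin_of_tendsto_nhds
    exact Continuous.tendsto (by fun_prop) 0
  have := ge_of_tendsto ht (eventually_nhdsWithin_of_forall key)
  simp only [add_zero] at this
  linarith

theorem SK_nonneg {k : ℕ} {ρ : A → ℝ} (h : ρ ∈ SK A k) (a : A) : 0 ≤ ρ a := by
  obtain ⟨h1, h2, -, -⟩ := h
  have hz : ρ 0 = 0 := by simpa using h2 0 0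
  have hneg : ρ (-a) = ρ a := by simpa using h2 (-1) a
  have h' := h1 a (-a)
  rw [add_neg_cancel, hz, hneg] at h'
  linarith

theorem SK_lim {k : ℕ} {ρ : ℕ → A → ℝ} {σ : A → ℝ} (h : ∀ n, ρ n ∈ SK A k)
    (hl : ∀ a, Tendsto (fun n => ρ n a) atTop (𝓝 (σ a))) : σ ∈ SK A k := by
  refine ⟨fun a b => ?_, fun c a => ?_, fun a b => ?_, fun a => ?_⟩
  · exact le_of_tendsto_of_tendsto' (hl _) ((hl a).add (hl b)) fun n => (h n).1 a b
  · refine tendsto_nhds_unique (hl (c • a)) ?_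
    simpa only [(h _).2.1 c a] using (hl a).const_mul ‖c‖
  · exact le_of_tendsto_of_tendsto' (hl _) ((hl a).mul (hl b)) fun n => (h n).2.2.1 a b
  · exact le_of_tendsto' (hl a) fun n => (h n).2.2.2 a

/-- Convergence of seminorms yields convergence of kernels in `τ_∞`. -/
theorem ker_tendsto {k : ℕ} {ρ : ℕ → SK A k} {σ : SK A k}
    (hl : ∀ a, Tendsto (fun n => (ρ n).1 a) atTop (𝓝 (σ.1 a))) :
    Tendsto (fun n => kerSK A k (ρ n)) atTop (@nhds _ (tauInfty A) (kerSK A k σ)) := by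
  have h1 : Tendsto ρ atTop (𝓝 σ) := by
    rw [tendsto_subtype_rng, tendsto_pi_nhds]
    exact hl
  have h2 : @Continuous _ _ _ (tauInfty A) (kerSK A k) := by
    rw [continuous_iff_coinduced_le]
    exact le_iSup (tauK A) k
  letI := tauInfty A
  exact (h2.tendsto σ).comp h1

theorem semiprime_of_t2 (h : @T2Space (ClosedIdeals A) (tauInfty A)) {J K : ClosedIdeals A}
    (hJK : J ≤ K) (hKK : ∀ x ∈ K.1, ∀ y ∈ K.1, x * y ∈ J.1) : J = K := by
  let e : ℕ → ℝ := fun n => 1 / ((n : ℝ) + 1)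
  have e0 : ∀ n, 0 < e n := fun n => Nat.one_div_pos_of_nat
  have e1 : ∀ n, e n ≤ 1 := fun n => by
    simp only [e]
    rw [div_le_one (by positivity)]
    linarith [(Nat.cast_nonneg n : (0 : ℝ) ≤ n)]
  have mem : ∀ ε : ℝ, 0 ≤ ε → ε ≤ 1 →
      (fun a => 2 * qnorm A a K.1 + 2 * ε * qnorm A a J.1) ∈ SK A 4 := by
    intro ε h0 h1
    refine ⟨fun a b => ?_, fun c a => ?_, fun a b => ?_, fun a => ?_⟩
    · have := qn_add K a b
      have h2 := mul_le_mul_of_nonneg_left (qn_add J a b) h0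
      simp only
      linarith
    · simp only [qn_smul]; ring
    · have h2 := qn_mul K a b
      have h3 := mul_le_mul_of_nonneg_left (qn_mul_sq hKK a b) h0
      have a1 := qn_nonneg K a
      have b1 := qn_nonneg K b
      have a2 := qn_nonneg J a
      have b2 := qn_nonneg J b
      have h4 := mul_nonneg (sub_nonneg.2 h1) (mul_nonneg a1 b1)
      have h5 := mul_nonneg (mul_nonneg h0 a1) b2
      have h6 := mul_nonneg (mul_nonneg h0 a2) b1
      have h7 := mul_nonneg (mul_nonneg h0 h0) (mul_nonneg a2 b2)
      simp only
      nlinarith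
    · have h2 := qn_le_norm K a
      have h3 := qn_le_norm J a
      have h4 := mul_le_mul h1 h3 (qn_nonneg J a) zero_le_one
      simp only
      push_cast
      linarith
  have hl := ker_tendsto (A := A) (k := 4) (ρ := fun n => ⟨_, mem (e n) (e0 n).le (e1 n)⟩)
    (σ := ⟨_, mem 0 le_rfl zero_le_one⟩) (by
      intro a
      have ht : Tendsto e atTop (𝓝 0) := tendsto_one_div_add_atTop_nhds_zero_nat
      exact ((ht.const_mul 2).mul_const _).const_add _)
  have hk : ∀ n, kerSK A 4 ⟨_, mem (e n) (e0 n).le (e1 n)⟩ = J := by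
    intro n
    apply Subtype.ext
    ext a
    change 2 * qnorm A a K.1 + 2 * e n * qnorm A a J.1 = 0 ↔ _
    constructor
    · intro h0
      rw [← qn_zero_iff]
      have a1 := qn_nonneg K a
      have a2 := qn_nonneg J a
      have h3 : e n * qnorm A a J.1 = 0 := by
        have := mul_nonneg (e0 n).le a2
        linarith
      exact (mul_eq_zero.1 h3).resolve_left (e0 n).ne'
    · intro ha
      rw [qn_zero_iff.2 ha, qn_zero_iff.2 (hJK ha)]
      simp
  have hk' : kerSK A 4 ⟨_, mem 0 le_rfl zero_le_one⟩ = K := by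
    apply Subtype.ext
    ext a
    change 2 * qnorm A a K.1 + 2 * 0 * qnorm A a J.1 = 0 ↔ _
    rw [← qn_zero_iff]
    constructor
    · intro h0; linarith
    · intro h0; rw [h0]; simp
  simp only [hk, hk'] at hl
  letI := tauInfty A
  exact tendsto_nhds_unique tendsto_const_nhds hl

/-! ### The complete lattice of closed ideals -/

theorem sInter_closedIdeal (S : Set (ClosedIdeals A)) :
    IsClosedIdeal A {a | ∀ I ∈ S, a ∈ I.1} := by
  refine ⟨?_, ?_, ?_, ?_, ?_⟩
  · simp only [Set.setOf_forall]
    exact isClosed_iInter fun I => isClosed_iInter fun _ => I.2.1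
  · exact fun I _ => I.2.2.1
  · exact fun x hx y hy I hI => id_add I (hx I hI) (hy I hI)
  · exact fun c x hx I hI => I.2.2.2.2.1 c x (hx I hI)
  · exact fun x hx a => ⟨fun I hI => id_mul_left I a (hx I hI),
      fun I hI => id_mul_right I a (hx I hI)⟩

noncomputable instance : InfSet (ClosedIdeals A) :=
  ⟨fun S => ⟨_, sInter_closedIdeal S⟩⟩

noncomputable instance : CompleteLattice (ClosedIdeals A) :=
  completeLatticeOfInf _ (fun S => ⟨fun I hI _ ha => ha I hI, fun _ hJ _ ha _ hI => hJ hI ha⟩)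

theorem mem_inf_id {I J : ClosedIdeals A} {a : A} : a ∈ (I ⊓ J).1 ↔ a ∈ I.1 ∧ a ∈ J.1 := by
  constructor
  · intro h
    exact ⟨(inf_le_left : I ⊓ J ≤ I) h, (inf_le_right : I ⊓ J ≤ J) h⟩
  · rintro ⟨h1, h2⟩
    have key : IsClosedIdeal A {a | ∀ K ∈ ({I, J} : Set (ClosedIdeals A)), a ∈ K.1} :=
      sInter_closedIdeal _
    have hle : (⟨_, key⟩ : ClosedIdeals A) ≤ I ⊓ J :=
      le_inf (fun x hx => hx I (by simp)) (fun x hx => hx J (by simp))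
    apply hle
    intro K hK
    rcases hK with rfl | rfl
    · exact h1
    · exact h2

theorem univ_closedIdeal : IsClosedIdeal A (Set.univ : Set A) :=
  ⟨isClosed_univ, trivial, fun _ _ _ _ => trivial, fun _ _ _ => trivial,
    fun _ _ _ => ⟨trivial, trivial⟩⟩

theorem top_id_val : (⊤ : ClosedIdeals A).1 = Set.univ := by
  have : (⟨Set.univ, univ_closedIdeal⟩ : ClosedIdeals A) ≤ ⊤ := le_top
  exact Set.eq_univ_of_univ_subset this

theorem ne_top_iff {I : ClosedIdeals A} : I ≠ ⊤ ↔ I.1 ≠ Set.univ := by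
  rw [← top_id_val, Ne, Ne, Subtype.ext_iff]

theorem closure_directed (D : Set (ClosedIdeals A)) (hne : D.Nonempty)
    (hD : DirectedOn (· ≤ ·) D) : IsClosedIdeal A (closure {a | ∃ I ∈ D, a ∈ I.1}) := by
  obtain ⟨I₀, hI₀⟩ := hne
  refine ⟨isClosed_closure, ?_, ?_, ?_, ?_⟩
  · exact subset_closure ⟨I₀, hI₀, I₀.2.2.1⟩
  · intro x hx y hy
    refine map_mem_closure₂ continuous_add hx hy ?_
    rintro a ⟨I, hI, ha⟩ b ⟨J, hJ, hb⟩
    obtain ⟨K, hK, hIK, hJK⟩ := hD I hI J hJ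
    exact ⟨K, hK, id_add K (hIK ha) (hJK hb)⟩
  · intro c x hx
    refine map_mem_closure (continuous_const_smul c) hx ?_
    rintro a ⟨I, hI, ha⟩
    exact ⟨I, hI, I.2.2.2.2.1 c a ha⟩
  · intro x hx a
    constructor
    · refine map_mem_closure (continuous_const_mul a) hx ?_
      rintro b ⟨I, hI, hb⟩
      exact ⟨I, hI, id_mul_left I a hb⟩
    · refine map_mem_closure (f := fun x => x * a) (continuous_mul_const a) hx ?_
      rintro b ⟨I, hI, hb⟩
      exact ⟨I, hI, id_mul_right I a hb⟩

theorem rightRes (X W : ClosedIdeals A) : IsClosedIdeal A {b | ∀ a ∈ X.1, a * b ∈ W.1} := by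
  refine ⟨?_, ?_, ?_, ?_, ?_⟩
  · simp only [Set.setOf_forall]
    exact isClosed_iInter fun a => isClosed_iInter fun _ =>
      W.2.1.preimage (continuous_const_mul a)
  · intro a _
    rw [mul_zero]
    exact W.2.2.1
  · intro x hx y hy a ha
    rw [mul_add]
    exact id_add W (hx a ha) (hy a ha)
  · intro c x hx a ha
    rw [mul_smul_comm]
    exact W.2.2.2.2.1 c _ (hx a ha)
  · intro x hx b
    constructor
    · intro a ha
      rw [← mul_assoc]
      exact hx _ (id_mul_right X b ha)
    · intro a ha
      rw [← mul_assoc]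
      exact id_mul_right W b (hx a ha)

theorem leftRes (X W : ClosedIdeals A) : IsClosedIdeal A {a | ∀ b ∈ X.1, a * b ∈ W.1} := by
  refine ⟨?_, ?_, ?_, ?_, ?_⟩
  · simp only [Set.setOf_forall]
    exact isClosed_iInter fun a => isClosed_iInter fun _ =>
      W.2.1.preimage (continuous_mul_const a)
  · intro a _
    rw [zero_mul]
    exact W.2.2.1
  · intro x hx y hy a ha
    rw [add_mul]
    exact id_add W (hx a ha) (hy a ha)
  · intro c x hx a ha
    rw [smul_mul_assoc]
    exact W.2.2.2.2.1 c _ (hx a ha)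
  · intro x hx b
    constructor
    · intro a ha
      rw [mul_assoc]
      exact id_mul_left W b (hx a ha)
    · intro a ha
      rw [mul_assoc]
      exact hx _ (id_mul_left X b ha)

theorem mul_sup_sub {X Y Z W : ClosedIdeals A} (h1 : ∀ x ∈ X.1, ∀ y ∈ Y.1, x * y ∈ W.1)
    (h2 : ∀ x ∈ X.1, ∀ y ∈ Z.1, x * y ∈ W.1) : ∀ x ∈ X.1, ∀ y ∈ (Y ⊔ Z).1, x * y ∈ W.1 := by
  have hle : Y ⊔ Z ≤ ⟨_, rightRes X W⟩ :=
    sup_le (fun y hy x hx => h1 x hx y hy) (fun y hy x hx => h2 x hx y hy)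
  exact fun x hx y hy => hle hy x hx

theorem sup_mul_sub {X Y Z W : ClosedIdeals A} (h1 : ∀ x ∈ Y.1, ∀ y ∈ X.1, x * y ∈ W.1)
    (h2 : ∀ x ∈ Z.1, ∀ y ∈ X.1, x * y ∈ W.1) : ∀ x ∈ (Y ⊔ Z).1, ∀ y ∈ X.1, x * y ∈ W.1 := by
  have hle : Y ⊔ Z ≤ ⟨_, leftRes X W⟩ :=
    sup_le (fun x hx y hy => h1 x hx y hy) (fun x hx y hy => h2 x hx y hy)
  exact fun x hx y hy => hle hx y hy

theorem inf_le_iff_mul (h : @T2Space (ClosedIdeals A) (tauInfty A)) {X Y P : ClosedIdeals A} :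
    X ⊓ Y ≤ P ↔ ∀ x ∈ X.1, ∀ y ∈ Y.1, x * y ∈ P.1 := by
  constructor
  · intro hle x hx y hy
    exact hle (mem_inf_id.2 ⟨id_mul_right X y hx, id_mul_left Y x hy⟩)
  · intro hxy
    have hP : P = (X ⊓ Y) ⊔ P := by
      refine semiprime_of_t2 h le_sup_right ?_
      refine sup_mul_sub ?_ (fun x hx y _ => id_mul_right P y hx)
      refine mul_sup_sub ?_ (fun x _ y hy => id_mul_left P x hy)
      intro x hx y hy
      exact hxy x (mem_inf_id.1 hx).1 y (mem_inf_id.1 hy).2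
    rw [hP]
    exact le_sup_left

theorem dist_of_t2 (h : @T2Space (ClosedIdeals A) (tauInfty A)) (X Y Z : ClosedIdeals A) :
    (X ⊔ Y) ⊓ (X ⊔ Z) ≤ X ⊔ (Y ⊓ Z) := by
  rw [inf_le_iff_mul h]
  have hX : X ≤ X ⊔ (Y ⊓ Z) := le_sup_left
  have hYZ : Y ⊓ Z ≤ X ⊔ (Y ⊓ Z) := le_sup_right
  refine sup_mul_sub (fun x hx y _ => id_mul_right _ y (hX hx)) ?_
  refine mul_sup_sub (fun x _ y hy => id_mul_left _ x (hX hy)) ?_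
  intro x hx y hy
  exact (inf_le_iff_mul h).1 hYZ x hx y hy

theorem prime_iff (h : @T2Space (ClosedIdeals A) (tauInfty A)) (P : ClosedIdeals A) :
    P ∈ PrimeSet A ↔ PrimeElt P := by
  constructor
  · rintro ⟨_, h1, h2⟩
    exact ⟨ne_top_iff.2 h1, fun X Y hXY => h2 X Y ((inf_le_iff_mul h).1 hXY)⟩
  · rintro ⟨h1, h2⟩
    exact ⟨P.2, ne_top_iff.1 h1, fun X Y hXY => h2 X Y ((inf_le_iff_mul h).2 hXY)⟩

/-- `M ε a` is the intersection of all closed ideals `K` with `‖a + K‖ < ε`. -/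
noncomputable def bigM (ε : ℝ) (a : A) : ClosedIdeals A := sInf {K | qnorm A a K.1 < ε}

theorem bigM_le {ε : ℝ} {a : A} {K : ClosedIdeals A} (h : qnorm A a K.1 < ε) : bigM ε a ≤ K :=
  sInf_le h

/-- The supremum seminorm. -/
noncomputable def supRho (ε : ℝ) (a : A) (x : A) : ℝ :=
  ⨆ K : {K : ClosedIdeals A // qnorm A a K.1 < ε}, qnorm A x K.1.1

theorem supRho_bdd (ε : ℝ) (a x : A) : BddAbove (Set.range
    fun K : {K : ClosedIdeals A // qnorm A a K.1 < ε} => qnorm A x K.1.1) := by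
  refine ⟨‖x‖, ?_⟩
  rintro _ ⟨K, rfl⟩
  exact qn_le_norm _ _

theorem supRho_nonempty {ε : ℝ} (hε : 0 < ε) (a : A) :
    Nonempty {K : ClosedIdeals A // qnorm A a K.1 < ε} := by
  refine ⟨⟨⊤, ?_⟩⟩
  rwa [qn_zero_iff.2]
  rw [top_id_val]
  trivial

theorem le_supRho {ε : ℝ} {a : A} {K : ClosedIdeals A} (h : qnorm A a K.1 < ε) (x : A) :
    qnorm A x K.1 ≤ supRho ε a x :=
  le_ciSup (supRho_bdd ε a x) ⟨K, h⟩

theorem supRho_nonneg {ε : ℝ} (a x : A) : 0 ≤ supRho ε a x :=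
  Real.iSup_nonneg fun _ => qn_nonneg _ _

theorem supRho_mem {ε : ℝ} (hε : 0 < ε) (a : A) : supRho ε a ∈ SK A 1 := by
  haveI := supRho_nonempty hε a
  refine ⟨fun x y => ?_, fun c x => ?_, fun x y => ?_, fun x => ?_⟩
  · exact ciSup_le fun K => (qn_add K.1 x y).trans
      (add_le_add (le_supRho K.2 x) (le_supRho K.2 y))
  · unfold supRho
    simp only [qn_smul]
    rw [Real.mul_iSup_of_nonneg (norm_nonneg c)]
  · exact ciSup_le fun K => (qn_mul K.1 x y).trans
      (mul_le_mul (le_supRho K.2 x) (le_supRho K.2 y) (qn_nonneg _ _) (supRho_nonneg _ _))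
  · exact ciSup_le fun K => by simpa using qn_le_norm K.1 x

theorem supRho_ker {ε : ℝ} (hε : 0 < ε) (a : A) :
    kerSK A 1 ⟨_, supRho_mem hε a⟩ = bigM ε a := by
  haveI := supRho_nonempty hε a
  apply Subtype.ext
  ext x
  change supRho ε a x = 0 ↔ ∀ K ∈ {K : ClosedIdeals A | qnorm A a K.1 < ε}, x ∈ K.1
  constructor
  · intro h0 K hK
    rw [← qn_zero_iff]
    exact le_antisymm ((le_supRho hK x).trans h0.le) (qn_nonneg _ _)
  · intro h0
    refine le_antisymm (ciSup_le fun K => ?_) (supRho_nonneg _ _)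
    exact (qn_zero_iff.2 (h0 K.1 K.2)).le

theorem qn_ker (I : ClosedIdeals A) : kerSK A 1 ⟨_, qn_mem_SK I⟩ = I := by
  apply Subtype.ext
  ext x
  exact qn_zero_iff

theorem anti_lim {f : ℕ → ℝ} (hf : Antitone f) (h0 : ∀ n, 0 ≤ f n) :
    Tendsto f atTop (𝓝 (⨅ n, f n)) :=
  tendsto_atTop_ciInf hf ⟨0, by rintro _ ⟨n, rfl⟩; exact h0 n⟩

theorem bigM_not_le (h : @T2Space (ClosedIdeals A) (tauInfty A)) {a : A} {J : ClosedIdeals A}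
    (ha : a ∉ J.1) : ∃ ε > 0, ¬ bigM ε a ≤ J := by
  by_contra! hcon
  let e : ℕ → ℝ := fun n => 1 / ((n : ℝ) + 1)
  have e0 : ∀ n, 0 < e n := fun n => Nat.one_div_pos_of_nat
  have eanti : Antitone e := fun m n hmn => Nat.one_div_le_one_div hmn
  have ht : Tendsto e atTop (𝓝 0) := tendsto_one_div_add_atTop_nhds_zero_nat
  have Mmono : Monotone fun n => bigM (e n) a := fun m n hmn =>
    sInf_le_sInf fun K hK => lt_of_lt_of_le hK (eanti hmn)
  have l1 : ∀ x, Tendsto (fun n => qnorm A x (bigM (e n) a).1) atTop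
      (𝓝 (⨅ n, qnorm A x (bigM (e n) a).1)) := fun x =>
    anti_lim (fun m n hmn => qn_anti (Mmono hmn) x) fun n => qn_nonneg _ _
  have l2 : ∀ x, Tendsto (fun n => supRho (e n) a x) atTop (𝓝 (⨅ n, supRho (e n) a x)) := by
    intro x
    refine anti_lim (fun m n hmn => ?_) fun n => supRho_nonneg _ _
    haveI := supRho_nonempty (e0 n) a
    exact ciSup_le fun K => le_supRho (lt_of_lt_of_le K.2 (eanti hmn)) x
  have s1 := SK_lim (fun n => qn_mem_SK (bigM (e n) a)) l1
  have s2 := SK_lim (fun n => supRho_mem (e0 n) a) l2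
  have t1 := ker_tendsto (ρ := fun n => ⟨_, qn_mem_SK (bigM (e n) a)⟩) (σ := ⟨_, s1⟩) l1
  have t2 := ker_tendsto (ρ := fun n => ⟨_, supRho_mem (e0 n) a⟩) (σ := ⟨_, s2⟩) l2
  have t1' := t1.congr fun n => qn_ker (bigM (e n) a)
  have t2' := t2.congr fun n => supRho_ker (e0 n) a
  have heq : kerSK A 1 ⟨_, s1⟩ = kerSK A 1 ⟨_, s2⟩ := by
    letI := tauInfty A
    exact tendsto_nhds_unique t1' t2'
  have ha2 : a ∈ (kerSK A 1 ⟨_, s2⟩).1 := by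
    change (⨅ n, supRho (e n) a a) = 0
    refine le_antisymm (le_of_tendsto_of_tendsto' (l2 a) ht fun n => ?_)
      (Real.iInf_nonneg fun _ => supRho_nonneg _ _)
    haveI := supRho_nonempty (e0 n) a
    exact ciSup_le fun K => K.2.le
  rw [← heq] at ha2
  have ha1 : (⨅ n, qnorm A a (bigM (e n) a).1) = 0 := ha2
  have hle : qnorm A a J.1 ≤ 0 := by
    rw [← ha1]
    exact ge_of_tendsto' (l1 a) fun n => qn_anti (hcon (e n) (e0 n)) a
  exact ha (qn_zero_iff.1 (le_antisymm hle (qn_nonneg _ _)))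

theorem contLat_of_t2 (h : @T2Space (ClosedIdeals A) (tauInfty A)) :
    ContLat (ClosedIdeals A) := by
  intro X Y hXY
  obtain ⟨a, haX, haY⟩ := Set.not_subset.1 hXY
  obtain ⟨ε, hε, hM⟩ := bigM_not_le h haY
  refine ⟨bigM ε a, ?_, hM⟩
  intro D hne hD hle
  have h1 : sSup D ≤ ⟨_, closure_directed D hne hD⟩ :=
    sSup_le fun I hI x hx => subset_closure ⟨I, hI, hx⟩
  have h2 : a ∈ closure {a | ∃ I ∈ D, a ∈ I.1} := h1 (hle haX)
  obtain ⟨b, ⟨I, hI, hb⟩, hab⟩ := Metric.mem_closure_iff.1 h2 ε hε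
  refine ⟨I, hI, bigM_le (qn_lt.2 ⟨b, hb, ?_⟩)⟩
  rwa [← dist_eq_norm]

end QN

/-- Theorem 1.11 of the paper: if `τ_∞` is Hausdorff on `Id(A)` then `A` has weak
spectral synthesis: `Prime(A)` is locally compact in the hull-kernel topology,
the hull-kernel topology has the normality property on `Prime(A)`, and every
proper closed two-sided ideal of `A` is an intersection of closed prime ideals. -/
theorem weak_spectral_synthesis_of_tauInfty_t2
    (h : @T2Space (ClosedIdeals A) (tauInfty A)) :
    @LocallyCompactSpace (PrimeSet A) (restrictTop A (PrimeSet A) (tauW A)) ∧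
      HasNormality A (PrimeSet A) (restrictTop A (PrimeSet A) (tauW A)) ∧
      ∀ I : ClosedIdeals A, I.1 ≠ Set.univ →
        I.1 = ⋂₀ {P : Set A | IsPrimeIdealSet A P ∧ I.1 ⊆ P} := by
  refine ⟨?_, ?_, ?_⟩
  · exact locallyCompact_primes (contLat_of_t2 h) (dist_of_t2 h) (PrimeSet A) (prime_iff h)
  · intro D _ hD net I hnet a ha
    obtain ⟨ε, hε, hM⟩ := bigM_not_le h ha
    letI : TopologicalSpace (PrimeSet A) := restrictTop A (PrimeSet A) (tauW A)
    have hopen : {Q : PrimeSet A | ¬ bigM ε a ≤ Q.1} ∈ 𝓝 I := by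
      letI : TopologicalSpace (ClosedIdeals A) := tauW A
      refine mem_nhds_induced _ _ _ |>.2 ⟨{Q | ¬ bigM ε a ≤ Q}, ?_, fun _ hq => hq⟩
      exact IsOpen.mem_nhds
        (TopologicalSpace.isOpen_generateFrom_of_mem ⟨bigM ε a, rfl⟩) hM
    refine lt_of_lt_of_le hε (le_liminf_of_le ?_ ?_)
    · refine IsBoundedUnder.isCoboundedUnder_ge (u := fun d => qnorm A a (net d).1.1) ?_
      exact isBoundedUnder_of ⟨‖a‖, fun d => qn_le_norm _ _⟩
    · filter_upwards [hnet hopen] with d hd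
      by_contra! hlt
      exact hd (bigM_le hlt)
  · intro I _
    apply Set.Subset.antisymm
    · exact Set.subset_sInter fun P hP => hP.2
    · intro a ha
      by_contra haI
      obtain ⟨ε, hε, hM⟩ := bigM_not_le h haI
      have hnle : ¬ (⊤ : ClosedIdeals A) ≤ I := fun hc => hM (le_top.trans hc)
      have hnle2 : ¬ (sInf {K : ClosedIdeals A | a ∈ K.1}) ≤ I := fun hc =>
        haI (hc (fun K hK => hK))
      obtain ⟨x, hx, hxI⟩ := contLat_of_t2 h _ _ hnle2
      obtain ⟨F, hF, hyF, hxF⟩ := exists_openFilt (contLat_of_t2 h) hx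
      obtain ⟨p, hp, hIp, hpF⟩ := exists_prime_notMem (dist_of_t2 h) hF ⟨_, hyF⟩
        (fun hIF => hxI (hxF _ hIF))
      have hap : a ∈ p.1 := ha p.1 ⟨(prime_iff h p).2 hp, hIp⟩
      exact hpF (hF.up _ _ hyF (sInf_le hap))

end BanachAlgebraPrelude
end

section
/- Let A be a commutative Banach algebra over ℂ, and let Prim(A) = {ker φ : φ a character of A}. Then the following are equivalent. (1) A has spectral synthesis in the sense of the paper: (i′) the set of proper closed prime ideals of A which are intersections of kernels of characters is locally compact in the hull-kernel topology; (ii′) the hull-kernel topology has the normality property on Prim(A); (iii′) every proper closed ideal of A equals the intersection of the kernels of the characters whose kernel contains it. (2) A has spectral synthesis in the usual sense: the hull-kernel topology coincides with the Gelfand topology on Prim(A), and every proper closed ideal of A equals the intersection of the kernels of the characters whose kernel contains it. -/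
set_option linter.unusedSectionVars false

open Filter Topology

section BanachAlgebraPrelude

variable (A : Type*) [NonUnitalNormedRing A] [NormedSpace ℂ A]
  [IsScalarTower ℂ A A] [SMulCommClass ℂ A A] [CompleteSpace A]

/-- The set of proper closed prime ideals of `A` which are intersections of kernels
of characters (the semisimple prime ideals, i.e. the sobrification `Prim^s(A)` in
the commutative case). -/
def SemisimplePrimeSet : Set (ClosedIdeals A) :=
  {P | IsPrimeIdealSet A P.1 ∧
    P.1 = ⋂ (φ : Characters A), ⋂ (_ : P.1 ⊆ charKer A φ.1), charKer A φ.1}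

/-! ### Helper lemmas -/

/-- The closed ideal generated by `x`. -/
def genIdeal (x : A) : ClosedIdeals A :=
  ⟨⋂ (I : ClosedIdeals A), ⋂ (_ : x ∈ I.1), I.1, by
    refine ⟨isClosed_iInter fun I => isClosed_iInter fun _ => I.2.1, ?_, ?_, ?_, ?_⟩
    · simp only [Set.mem_iInter]
      exact fun I _ => I.2.2.1
    · simp only [Set.mem_iInter]
      exact fun u hu v hv I hI => I.2.2.2.1 u (hu I hI) v (hv I hI)
    · simp only [Set.mem_iInter]
      exact fun c u hu I hI => I.2.2.2.2.1 c u (hu I hI)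
    · simp only [Set.mem_iInter]
      exact fun u hu a => ⟨fun I hI => (I.2.2.2.2.2 u (hu I hI) a).1,
        fun I hI => (I.2.2.2.2.2 u (hu I hI) a).2⟩⟩

theorem mem_genIdeal (x : A) : x ∈ (genIdeal A x).1 := by
  simp only [genIdeal, Set.mem_iInter]
  exact fun I hI => hI

theorem genIdeal_subset {x : A} {I : ClosedIdeals A} (h : x ∈ I.1) :
    (genIdeal A x).1 ⊆ I.1 := by
  intro y hy
  simp only [genIdeal, Set.mem_iInter] at hy
  exact hy I h

theorem isOpen_not_mem (x : A) : IsOpen[tauW A] {I : ClosedIdeals A | x ∉ I.1} := by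
  apply TopologicalSpace.isOpen_generateFrom_of_mem
  refine ⟨genIdeal A x, ?_⟩
  ext I
  simp only [Set.mem_ofPred_eq]
  exact not_congr ⟨fun h => genIdeal_subset A h, fun h => h (mem_genIdeal A x)⟩

theorem tauW_down {U : Set (ClosedIdeals A)} (hU : IsOpen[tauW A] U)
    {I J : ClosedIdeals A} (hJI : J.1 ⊆ I.1) (hI : I ∈ U) : J ∈ U := by
  have hU' : TopologicalSpace.GenerateOpen
    {U | ∃ J : ClosedIdeals A, U = {I | ¬ J.1 ⊆ I.1}} U := hU
  clear hU
  induction hU' with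
  | basic s hs =>
    obtain ⟨K, rfl⟩ := hs
    exact fun h => hI (h.trans hJI)
  | univ => trivial
  | inter s t _ _ h1 h2 => exact ⟨h1 hI.1, h2 hI.2⟩
  | sUnion S _ h =>
    obtain ⟨s, hs, hIs⟩ := hI
    exact ⟨s, hs, h s hs hIs⟩

theorem tauW_base {U : Set (ClosedIdeals A)} (hU : IsOpen[tauW A] U)
    (φ : Characters A) (hφ : charKerIdeal A φ ∈ U) :
    ∃ x, φ.1 x ≠ 0 ∧ ∀ ψ : Characters A, ψ.1 x ≠ 0 → charKerIdeal A ψ ∈ U := by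
  have hU' : TopologicalSpace.GenerateOpen
    {U | ∃ J : ClosedIdeals A, U = {I | ¬ J.1 ⊆ I.1}} U := hU
  clear hU
  induction hU' with
  | basic s hs =>
    obtain ⟨K, rfl⟩ := hs
    obtain ⟨x, hxK, hx⟩ := Set.not_subset.1 hφ
    exact ⟨x, hx, fun ψ hψ h => hψ (h hxK)⟩
  | univ =>
    have : ∃ x, φ.1 x ≠ 0 := by
      by_contra! h
      exact φ.2.1 (funext h)
    obtain ⟨x, hx⟩ := this
    exact ⟨x, hx, fun _ _ => trivial⟩
  | inter s t _ _ h1 h2 =>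
    obtain ⟨x, hx, hx'⟩ := h1 hφ.1
    obtain ⟨y, hy, hy'⟩ := h2 hφ.2
    refine ⟨x * y, ?_, fun ψ hψ => ?_⟩
    · rw [φ.2.2.2.2.2]
      exact mul_ne_zero hx hy
    · rw [ψ.2.2.2.2.2] at hψ
      exact ⟨hx' ψ (left_ne_zero_of_mul hψ), hy' ψ (right_ne_zero_of_mul hψ)⟩
  | sUnion S _ h =>
    obtain ⟨s, hs, hIs⟩ := hφ
    obtain ⟨x, hx, hx'⟩ := h s hs hIs
    exact ⟨x, hx, fun ψ hψ => ⟨s, hs, hx' ψ hψ⟩⟩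

theorem char_sub (φ : Characters A) (x y : A) : φ.1 (x - y) = φ.1 x - φ.1 y := by
  have h : x - y = x + (-1 : ℂ) • y := by
    rw [neg_one_smul, sub_eq_add_neg]
  rw [h, φ.2.2.2.1, φ.2.2.2.2.1]
  ring

theorem char_smul (φ : Characters A) (c : ℂ) (x : A) : φ.1 (c • x) = c * φ.1 x :=
  φ.2.2.2.2.1 c x

theorem char_mul (φ : Characters A) (x y : A) : φ.1 (x * y) = φ.1 x * φ.1 y :=
  φ.2.2.2.2.2 x y

theorem char_zero (φ : Characters A) : φ.1 0 = 0 := by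
  simpa using char_smul A φ 0 0

theorem char_exists (φ : Characters A) : ∃ x, φ.1 x ≠ 0 := by
  by_contra! h
  exact φ.2.1 (funext h)

theorem char_ext (φ ψ : Characters A) (h : charKer A φ.1 ⊆ charKer A ψ.1) : φ = ψ := by
  obtain ⟨e, he⟩ := char_exists A ψ
  have he' : φ.1 e ≠ 0 := fun h' => he (h h')
  have key : ∀ a, φ.1 e * ψ.1 a = φ.1 a * ψ.1 e := by
    intro a
    have h1 : φ.1 e • a - φ.1 a • e ∈ charKer A φ.1 := by
      show φ.1 _ = 0
      rw [char_sub, char_smul, char_smul]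
      ring
    have h2 : ψ.1 _ = 0 := h h1
    rw [char_sub, char_smul, char_smul] at h2
    exact sub_eq_zero.1 h2
  have h3 := key (e * e)
  rw [char_mul, char_mul] at h3
  have h4 : ψ.1 e = φ.1 e := by
    have : (φ.1 e * ψ.1 e) * ψ.1 e = (φ.1 e * ψ.1 e) * φ.1 e := by linear_combination h3
    exact mul_left_cancel₀ (mul_ne_zero he' he) this
  apply Subtype.ext
  funext a
  have h5 := key a
  rw [h4] at h5
  exact (mul_left_cancel₀ he' (h5.trans (mul_comm _ _))).symm

theorem char_norm_le (φ : Characters A) (x : A) : ‖φ.1 x‖ ≤ ‖x‖ := by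
  by_contra! hlt
  have hne : φ.1 x ≠ 0 := by
    intro h
    rw [h, norm_zero] at hlt
    exact absurd hlt (not_lt.2 (norm_nonneg x))
  set y : A := (φ.1 x)⁻¹ • x with hy
  have hφy : φ.1 y = 1 := by
    rw [hy, char_smul, inv_mul_cancel₀ hne]
  have hny : ‖y‖ < 1 := by
    rw [hy, norm_smul, norm_inv, inv_mul_lt_iff₀ (norm_pos_iff.2 hne)]
    simpa using hlt
  let u : ℕ → A := fun n => Nat.rec y (fun _ z => y * z) n
  have hu1 : ∀ n, φ.1 (u n) = 1 := by
    intro n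
    induction n with
    | zero => exact hφy
    | succ n ih =>
      show φ.1 (y * u n) = 1
      rw [char_mul, hφy, ih, one_mul]
  have hu2 : ∀ n, ‖u n‖ ≤ ‖y‖ ^ n := by
    intro n
    induction n with
    | zero =>
      rw [pow_zero]
      exact hny.le
    | succ n ih =>
      show ‖y * u n‖ ≤ _
      calc ‖y * u n‖ ≤ ‖y‖ * ‖u n‖ := norm_mul_le _ _
        _ ≤ ‖y‖ * ‖y‖ ^ n := by gcongr
        _ = ‖y‖ ^ (n + 1) := by ring
  have hlim : Tendsto u atTop (𝓝 0) :=
    squeeze_zero_norm hu2 (tendsto_pow_atTop_nhds_zero_of_lt_one (norm_nonneg y) hny)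
  have h1 : Tendsto (fun n => φ.1 (u n)) atTop (𝓝 (φ.1 0)) :=
    (φ.2.2.1.tendsto 0).comp hlim
  simp only [hu1, char_zero] at h1
  exact one_ne_zero (tendsto_nhds_unique tendsto_const_nhds h1)

theorem gelfandMap_bijective : Function.Bijective (gelfandMap A) := by
  constructor
  · intro φ ψ h
    apply char_ext
    have h1 : (gelfandMap A φ).1.1 = (gelfandMap A ψ).1.1 := by rw [h]
    exact h1.subset
  · rintro ⟨_, φ, rfl⟩
    exact ⟨φ, rfl⟩

theorem top_eq_iff :
    restrictTop A (PrimSet A) (tauW A) = gelfandTop A ↔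
      (inferInstance : TopologicalSpace (Characters A)) =
        TopologicalSpace.induced (charKerIdeal A) (tauW A) := by
  let e := Equiv.ofBijective _ (gelfandMap_bijective A)
  have h1 : TopologicalSpace.induced (charKerIdeal A) (tauW A) =
      TopologicalSpace.induced e (restrictTop A (PrimSet A) (tauW A)) := by
    rw [restrictTop, induced_compose]
    rfl
  have h2 : gelfandTop A = TopologicalSpace.induced e.symm
      (inferInstance : TopologicalSpace (Characters A)) := by
    rw [e.induced_symm]
    rfl
  rw [h1, h2]
  constructor
  · intro h
    rw [h, induced_compose]
    simp [induced_id]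
  · intro h
    rw [h, induced_compose]
    simp [induced_id]

theorem charKerIdeal_cont :
    (inferInstance : TopologicalSpace (Characters A)) ≤
        TopologicalSpace.induced (charKerIdeal A) (tauW A) := by
  rw [← continuous_iff_le_induced, tauW, continuous_generateFrom_iff]
  rintro _ ⟨J, rfl⟩
  have : charKerIdeal A ⁻¹' {I | ¬ J.1 ⊆ I.1} =
      ⋃ j ∈ J.1, {φ : Characters A | φ.1 j ≠ 0} := by
    ext φ
    simp only [Set.mem_preimage, Set.mem_ofPred_eq, Set.mem_iUnion, Set.not_subset]
    constructor
    · rintro ⟨j, hj, h⟩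
      exact ⟨j, hj, h⟩
    · rintro ⟨j, hj, h⟩
      exact ⟨j, hj, h⟩
  rw [this]
  refine isOpen_biUnion fun j _ => ?_
  exact isOpen_ne_fun ((continuous_apply j).comp continuous_subtype_val) continuous_const

theorem filter_normality (hN : HasNormality A (PrimSet A) (restrictTop A (PrimSet A) (tauW A)))
    {D : Type} (F : Filter D) [F.NeBot] (u : D → Characters A) (χ : Characters A)
    (hu : Tendsto (fun d => charKerIdeal A (u d)) F (@nhds _ (tauW A) (charKerIdeal A χ)))
    (b : A) (hb : χ.1 b ≠ 0) :
    ∃ δ > 0, ∀ᶠ d in F, δ ≤ qnorm A b (charKer A (u d).1) := by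
  let D' : Type := {p : Set D × D // p.1 ∈ F ∧ p.2 ∈ p.1}
  let : Preorder D' := Preorder.lift (fun p : D' => OrderDual.toDual p.1.1)
  have hle : ∀ p q : D', p ≤ q ↔ q.1.1 ⊆ p.1.1 := fun p q => Iff.rfl
  obtain ⟨d0, -⟩ := F.nonempty_of_mem univ_mem
  have : Nonempty D' := ⟨⟨(Set.univ, d0), univ_mem, trivial⟩⟩
  have : IsDirectedOrder D' := ⟨by
    intro p q
    have hm := inter_mem p.2.1 q.2.1
    obtain ⟨d, hd⟩ := F.nonempty_of_mem hm
    exact ⟨⟨(_, d), hm, hd⟩, Set.inter_subset_left, Set.inter_subset_right⟩⟩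
  have hT : Tendsto (fun p : D' => p.1.2) atTop F := by
    intro S hS
    obtain ⟨d, hd⟩ := F.nonempty_of_mem hS
    refine mem_map.2 (mem_atTop_sets.2 ⟨⟨(S, d), hS, hd⟩, fun q hq => ?_⟩)
    exact (hle _ _).1 hq q.2.2
  have h := hN D' inferInstance (fun p => gelfandMap A (u p.1.2)) (gelfandMap A χ) (by
    rw [restrictTop, @nhds_induced _ _ (tauW A), tendsto_comap_iff]
    exact hu.comp hT) b hb
  obtain ⟨δ, hδ0, hδ⟩ := exists_between h
  refine ⟨δ, hδ0, ?_⟩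
  have hev := eventually_lt_of_lt_liminf hδ
    (isBoundedUnder_of_eventually_ge (Eventually.of_forall fun p => Metric.infDist_nonneg (s := charKer A (u p.1.2).1) (x := b)))
  obtain ⟨p, hp⟩ := mem_atTop_sets.1 hev
  refine mem_of_superset p.2.1 fun d hd => ?_
  have hlt : δ < qnorm A b (charKer A (u d).1) :=
    hp ⟨(p.1.1, d), p.2.1, hd⟩ ((hle _ _).2 subset_rfl)
  exact hlt.le

theorem qnorm_bound (φ : Characters A) (b c : A) :
    ‖φ.1 c‖ * qnorm A b (charKer A φ.1) ≤ ‖φ.1 b‖ * ‖c‖ := by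
  by_cases hc : φ.1 c = 0
  · rw [hc, norm_zero, zero_mul]
    positivity
  have h1 : b - (φ.1 b / φ.1 c) • c ∈ charKer A φ.1 := by
    show φ.1 _ = 0
    rw [char_sub, char_smul, div_mul_cancel₀ _ hc, sub_self]
  have h2 : qnorm A b (charKer A φ.1) ≤ ‖φ.1 b‖ / ‖φ.1 c‖ * ‖c‖ := by
    refine (Metric.infDist_le_dist_of_mem h1).trans ?_
    rw [dist_eq_norm, sub_sub_cancel, norm_smul, norm_div]
  have h3 : 0 < ‖φ.1 c‖ := norm_pos_iff.2 hc
  calc ‖φ.1 c‖ * qnorm A b (charKer A φ.1) ≤ ‖φ.1 c‖ * (‖φ.1 b‖ / ‖φ.1 c‖ * ‖c‖) := by gcongr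
    _ = ‖φ.1 b‖ * ‖c‖ := by field_simp

/-- Ultrafilters on small index types: hull-kernel convergence implies Gelfand convergence. -/
theorem ultra_conv (hN : HasNormality A (PrimSet A) (restrictTop A (PrimSet A) (tauW A)))
    {D : Type} (F : Ultrafilter D) (u : D → Characters A) (χ : Characters A)
    (hu : Tendsto (fun d => charKerIdeal A (u d)) F (@nhds _ (tauW A) (charKerIdeal A χ)))
    (a : A) : Tendsto (fun d => (u d).1 a) F (𝓝 (χ.1 a)) := by
  have hcpt : IsCompact (Metric.closedBall (0 : ℂ) ‖a‖) := isCompact_closedBall _ _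
  obtain ⟨t, -, ht⟩ := isCompact_iff_ultrafilter_le_nhds.1 hcpt (F.map fun d => (u d).1 a) (by
    rw [le_principal_iff]
    exact mem_map.2 (Eventually.of_forall fun d => by
      simpa using char_norm_le A (u d) a))
  have ht' : Tendsto (fun d => (u d).1 a) F (𝓝 t) := ht
  suffices h : t = χ.1 a by rwa [← h]
  by_contra hne
  obtain ⟨b, hb⟩ := char_exists A χ
  have hval : ∀ φ : Characters A, φ.1 (a * b - t • b) = (φ.1 a - t) * φ.1 b := by
    intro φ
    rw [char_sub, char_smul, char_mul]
    ring
  have hb' : χ.1 (a * b - t • b) ≠ 0 := by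
    rw [hval]
    exact mul_ne_zero (sub_ne_zero.2 (Ne.symm hne)) hb
  obtain ⟨δ, hδ, hev⟩ := filter_normality A hN (F : Filter D) u χ hu _ hb'
  obtain ⟨δ', hδ', hev'⟩ := filter_normality A hN (F : Filter D) u χ hu _ hb
  have hlim : Tendsto (fun d => ‖(u d).1 a - t‖ * ‖b‖) F (𝓝 (‖t - t‖ * ‖b‖)) :=
    ((ht'.sub_const t).norm).mul_const _
  rw [sub_self, norm_zero, zero_mul] at hlim
  obtain ⟨d, h1, h2, h3⟩ := (hev.and (hev'.and (hlim.eventually (gt_mem_nhds hδ)))).exists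
  have hbd : (u d).1 b ≠ 0 := by
    intro h0
    have : qnorm A b (charKer A (u d).1) = 0 := Metric.infDist_zero_of_mem h0
    linarith
  have hpos : 0 < ‖(u d).1 b‖ := norm_pos_iff.2 hbd
  have h4 := qnorm_bound A (u d) (a * b - t • b) b
  rw [hval, norm_mul] at h4
  have h5 : ‖(u d).1 b‖ * δ ≤ ‖(u d).1 b‖ * (‖(u d).1 a - t‖ * ‖b‖) := by
    calc ‖(u d).1 b‖ * δ ≤ ‖(u d).1 b‖ * qnorm A (a * b - t • b) (charKer A (u d).1) := by gcongr
      _ ≤ _ := h4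
      _ = _ := by ring
  have h6 := le_of_mul_le_mul_left h5 hpos
  linarith

theorem charKer_prime (φ : Characters A) : charKerIdeal A φ ∈ SemisimplePrimeSet A := by
  refine ⟨⟨(charKerIdeal A φ).2, ?_, ?_⟩, ?_⟩
  · intro h
    obtain ⟨e, he⟩ := char_exists A φ
    have : e ∈ (charKerIdeal A φ).1 := by rw [h]; trivial
    exact he this
  · intro I J h
    by_contra! hc
    obtain ⟨x, hx, hx'⟩ := Set.not_subset.1 hc.1
    obtain ⟨y, hy, hy'⟩ := Set.not_subset.1 hc.2
    have h1 : φ.1 (x * y) = 0 := h x hx y hy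
    rw [char_mul] at h1
    exact mul_ne_zero hx' hy' h1
  · apply subset_antisymm
    · intro x hx
      simp only [Set.mem_iInter]
      exact fun ψ hψ => hψ hx
    · intro x hx
      simp only [Set.mem_iInter] at hx
      exact hx φ subset_rfl

theorem exists_char_of_semisimplePrime {P : ClosedIdeals A} (hP : P ∈ SemisimplePrimeSet A) :
    ∃ χ : Characters A, P.1 ⊆ charKer A χ.1 := by
  by_contra! h
  apply hP.1.2.1
  rw [hP.2]
  refine Set.eq_univ_of_forall fun x => ?_
  simp only [Set.mem_iInter]
  exact fun φ hφ => absurd hφ (h φ)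

theorem forward_key
    (hL : @LocallyCompactSpace (SemisimplePrimeSet A)
        (restrictTop A (SemisimplePrimeSet A) (tauW A)))
    (hN : HasNormality A (PrimSet A) (restrictTop A (PrimSet A) (tauW A)))
    (φ₀ : Characters A) (a : A) (ε : ℝ) (hε : 0 < ε) :
    ∃ U, IsOpen[tauW A] U ∧ charKerIdeal A φ₀ ∈ U ∧
      ∀ φ : Characters A, charKerIdeal A φ ∈ U → dist (φ.1 a) (φ₀.1 a) < ε := by
  by_contra! hcon
  obtain ⟨e, he⟩ := char_exists A φ₀
  let T : Type := {t : ℂ // t ≠ φ₀.1 a}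
  let tw : TopologicalSpace (ClosedIdeals A) := tauW A
  let tS : TopologicalSpace (SemisimplePrimeSet A) :=
    restrictTop A (SemisimplePrimeSet A) (tauW A)
  have hval : ∀ (t : ℂ) (φ : Characters A), φ.1 (a * e - t • e) = (φ.1 a - t) * φ.1 e := by
    intro t φ
    rw [char_sub, char_smul, char_mul]
    ring
  let p₀ : SemisimplePrimeSet A := ⟨charKerIdeal A φ₀, charKer_prime A φ₀⟩
  -- compact neighbourhoods
  have hR : ∀ t : T, ∃ R : Set (SemisimplePrimeSet A), R ∈ 𝓝 p₀ ∧
      R ⊆ {P | a * e - t.1 • e ∉ P.1.1} ∧ IsCompact R := by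
    intro t
    have hopen : IsOpen {P : SemisimplePrimeSet A | a * e - t.1 • e ∉ P.1.1} :=
      isOpen_induced (isOpen_not_mem A (a * e - t.1 • e))
    have hmem : p₀ ∈ {P : SemisimplePrimeSet A | a * e - t.1 • e ∉ P.1.1} := by
      show ¬ (φ₀.1 _ = 0)
      rw [hval]
      exact mul_ne_zero (sub_ne_zero.2 (Ne.symm t.2)) he
    exact hL.local_compact_nhds p₀ _ (hopen.mem_nhds hmem)
  choose R hRn hRs hRc using hR
  have hy : ∀ s : Finset T, ∃ y : Characters A,
      (∀ t ∈ s, (⟨charKerIdeal A y, charKer_prime A y⟩ : SemisimplePrimeSet A) ∈ R t) ∧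
        ε ≤ dist (y.1 a) (φ₀.1 a) := by
    intro s
    have h1 : (⋂ t ∈ s, R t) ∈ 𝓝 p₀ := (Filter.biInter_finset_mem s).2 fun t _ => hRn t
    obtain ⟨V, hVs, hVo, hV0⟩ := mem_nhds_iff.1 h1
    obtain ⟨U, hU, rfl⟩ := isOpen_induced_iff.1 hVo
    obtain ⟨y, hyU, hyε⟩ := hcon U hU hV0
    refine ⟨y, fun t ht => ?_, hyε⟩
    have h2 := @hVs ⟨charKerIdeal A y, charKer_prime A y⟩ hyU
    simp only [Set.mem_iInter] at h2
    exact h2 t ht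
  choose y hyR hyε using hy
  classical
  let F : Ultrafilter (Finset T) := Ultrafilter.of atTop
  have hF : (F : Filter (Finset T)) ≤ atTop := Ultrafilter.of_le _
  let g : Finset T → SemisimplePrimeSet A := fun s => ⟨charKerIdeal A (y s), charKer_prime A (y s)⟩
  have hP : ∀ t : T, ∃ P ∈ R t, Tendsto g F (𝓝 P) := by
    intro t
    obtain ⟨P, hP, hPl⟩ := isCompact_iff_ultrafilter_le_nhds.1 (hRc t) (F.map g) (by
      rw [le_principal_iff]
      refine mem_map.2 (hF (mem_atTop_sets.2 ⟨{t}, fun s hs => ?_⟩))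
      exact hyR s t (hs (Finset.mem_singleton_self t)))
    exact ⟨P, hP, hPl⟩
  choose P hPR hPl using hP
  -- convergence to every character above `P t`
  have hconv : ∀ (t : T) (χ : Characters A), (P t).1.1 ⊆ charKer A χ.1 →
      ∀ b, Tendsto (fun s => (y s).1 b) F (𝓝 (χ.1 b)) := by
    intro t χ hχ
    apply ultra_conv A hN F y χ
    have h1 : Tendsto (fun s => charKerIdeal A (y s)) F (𝓝 (P t).1) :=
      ((continuous_induced_dom (f := Subtype.val)).tendsto (P t)).comp (hPl t)
    refine h1.mono_right ?_
    intro S hS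
    obtain ⟨U, hUS, hU, hχU⟩ := mem_nhds_iff.1 hS
    exact mem_nhds_iff.2 ⟨U, hUS, hU, tauW_down A hU hχ hχU⟩
  let t₀ : T := ⟨φ₀.1 a + 1, by simp⟩
  obtain ⟨χ, hχ⟩ := exists_char_of_semisimplePrime A (P t₀).2
  have hχc := hconv t₀ χ hχ
  have huniq : ∀ (t : T) (ψ : Characters A), (P t).1.1 ⊆ charKer A ψ.1 → ψ = χ := by
    intro t ψ hψ
    apply Subtype.ext
    funext b
    exact tendsto_nhds_unique (hconv t ψ hψ b) (hχc b)
  have hne : ∀ t : T, χ.1 (a * e - t.1 • e) ≠ 0 := by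
    intro t h0
    apply hRs t (hPR t)
    rw [(P t).2.2]
    simp only [Set.mem_iInter]
    intro ψ hψ
    rw [huniq t ψ hψ]
    exact h0
  have hχa : χ.1 a = φ₀.1 a := by
    by_contra h
    apply hne ⟨χ.1 a, h⟩
    rw [hval, sub_self, zero_mul]
  have hd : Tendsto (fun s => dist ((y s).1 a) (φ₀.1 a)) F (𝓝 (dist (χ.1 a) (φ₀.1 a))) :=
    (hχc a).dist tendsto_const_nhds
  have := ge_of_tendsto' hd hyε
  rw [hχa, dist_self] at this
  linarith

theorem forward
    (hL : @LocallyCompactSpace (SemisimplePrimeSet A)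
        (restrictTop A (SemisimplePrimeSet A) (tauW A)))
    (hN : HasNormality A (PrimSet A) (restrictTop A (PrimSet A) (tauW A))) :
    restrictTop A (PrimSet A) (tauW A) = gelfandTop A := by
  rw [top_eq_iff]
  apply le_antisymm (charKerIdeal_cont A)
  rw [← continuous_id_iff_le]
  let tw : TopologicalSpace (ClosedIdeals A) := tauW A
  refine @Continuous.subtype_mk _ _ _ (_) _ _ ?_ _
  refine @continuous_pi _ _ _ (_) _ _ ?_
  intro a
  refine @continuous_iff_continuousAt _ _ (_) _ _ |>.2 fun φ₀ => ?_
  refine Metric.tendsto_nhds.2 fun ε hε => ?_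
  obtain ⟨U, hU, h0, h⟩ := forward_key A hL hN φ₀ a ε hε
  rw [nhds_induced]
  exact mem_comap.2 ⟨U, hU.mem_nhds h0, fun φ hφ => h φ hφ⟩

theorem backward_normality
    (hT : (inferInstance : TopologicalSpace (Characters A)) =
        TopologicalSpace.induced (charKerIdeal A) (tauW A)) :
    HasNormality A (PrimSet A) (restrictTop A (PrimSet A) (tauW A)) := by
  intro D _ hD net I hI a ha
  choose u hu using fun d => (gelfandMap_bijective A).2 (net d)
  obtain ⟨χ, rfl⟩ := (gelfandMap_bijective A).2 I
  obtain rfl : (fun d => gelfandMap A (u d)) = net := funext hu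
  rw [restrictTop, @nhds_induced _ _ (tauW A), tendsto_comap_iff] at hI
  have h1 : Tendsto u atTop (𝓝 χ) := by
    have : 𝓝 χ = comap (charKerIdeal A) (@nhds _ (tauW A) (charKerIdeal A χ)) := by
      rw [← @nhds_induced _ _ (tauW A), ← hT]
    rw [this, tendsto_comap_iff]
    exact hI
  have h2 : Tendsto (fun d => ‖(u d).1 a‖) atTop (𝓝 ‖χ.1 a‖) :=
    (((continuous_apply a).comp continuous_subtype_val).tendsto χ |>.comp h1).norm
  have hpos : 0 < ‖χ.1 a‖ := norm_pos_iff.2 ha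
  refine lt_of_lt_of_le (half_pos hpos) (le_liminf_of_le ?_ ?_)
  · refine IsBoundedUnder.isCoboundedUnder_ge (isBoundedUnder_of_eventually_le (a := ‖a‖)
      (Eventually.of_forall fun d => ?_))
    have h0 : (0 : A) ∈ charKer A (u d).1 := char_zero A (u d)
    have := Metric.infDist_le_dist_of_mem (x := a) h0
    rwa [dist_zero_right] at this
  · filter_upwards [h2.eventually (lt_mem_nhds (half_lt_self hpos))] with d hd
    have h0 : (0 : A) ∈ charKer A (u d).1 := char_zero A (u d)
    refine hd.le.trans ((Metric.le_infDist ⟨0, h0⟩).2 fun m hm => ?_)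
    have hm' : (u d).1 m = 0 := hm
    have := char_norm_le A (u d) (a - m)
    rw [char_sub, hm', sub_zero] at this
    rwa [dist_eq_norm]

theorem characters_locallyCompact : LocallyCompactSpace (Characters A) := by
  let X : Set (A → ℂ) := {ψ | (∀ x, ψ x ∈ Metric.closedBall (0 : ℂ) ‖x‖) ∧
    (∀ x y, ψ (x + y) = ψ x + ψ y) ∧ (∀ (c : ℂ) (x : A), ψ (c • x) = c * ψ x) ∧
      ∀ x y, ψ (x * y) = ψ x * ψ y}
  have hX : IsCompact X := by
    have h1 : IsCompact (Set.univ.pi fun x : A => Metric.closedBall (0 : ℂ) ‖x‖) :=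
      isCompact_univ_pi fun x => isCompact_closedBall _ _
    refine h1.of_isClosed_subset ?_ fun ψ hψ x _ => hψ.1 x
    have hXe : X = (⋂ x, {ψ : A → ℂ | ψ x ∈ Metric.closedBall (0 : ℂ) ‖x‖}) ∩
        ((⋂ x, ⋂ y, {ψ : A → ℂ | ψ (x + y) = ψ x + ψ y}) ∩
        ((⋂ c : ℂ, ⋂ x, {ψ : A → ℂ | ψ (c • x) = c * ψ x}) ∩
          (⋂ x, ⋂ y, {ψ : A → ℂ | ψ (x * y) = ψ x * ψ y}))) := by
      ext ψ
      simp only [Set.mem_inter_iff, Set.mem_iInter]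
      rfl
    rw [hXe]
    refine IsClosed.inter ?_ (IsClosed.inter ?_ (IsClosed.inter ?_ ?_))
    · exact isClosed_iInter fun x => Metric.isClosed_closedBall.preimage (continuous_apply x)
    · exact isClosed_iInter fun x => isClosed_iInter fun y =>
        isClosed_eq (by fun_prop) (by fun_prop)
    · exact isClosed_iInter fun x => isClosed_iInter fun y =>
        isClosed_eq (by fun_prop) (by fun_prop)
    · exact isClosed_iInter fun x => isClosed_iInter fun y =>
        isClosed_eq (by fun_prop) (by fun_prop)
  have : CompactSpace X := isCompact_iff_compactSpace.1 hX
  let f : Characters A → X := fun φ =>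
    ⟨φ.1, fun x => by simpa using char_norm_le A φ x, φ.2.2.2⟩
  have hf : IsOpenEmbedding f := by
    refine ⟨⟨?_, ?_⟩, ?_⟩
    · refine IsInducing.of_comp (g := Subtype.val) ?_ continuous_subtype_val IsInducing.subtypeVal
      exact continuous_subtype_val.subtype_mk _
    · intro φ ψ h
      exact Subtype.ext (congrArg (fun z : X => z.1) h)
    · have : Set.range f = Subtype.val ⁻¹' ({0}ᶜ : Set (A → ℂ)) := by
        ext ψ
        constructor
        · rintro ⟨φ, rfl⟩
          exact φ.2.1
        · intro h
          refine ⟨⟨ψ.1, h, ?_, ψ.2.2⟩, rfl⟩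
          have hL : LipschitzWith 1 ψ.1 := by
            apply LipschitzWith.of_dist_le_mul
            intro x y
            have hs : ψ.1 x - ψ.1 y = ψ.1 (x - y) := by
              have h' : x - y = x + (-1 : ℂ) • y := by
                rw [neg_one_smul, sub_eq_add_neg]
              rw [h', ψ.2.2.1, ψ.2.2.2.1]
              ring
            have := ψ.2.1 (x - y)
            rw [dist_eq_norm, dist_eq_norm, hs]
            simpa using this
          exact hL.continuous
      rw [this]
      exact isOpen_compl_singleton.preimage continuous_subtype_val
  exact hf.locallyCompactSpace

theorem semisimplePrime_eq
    (hT : (inferInstance : TopologicalSpace (Characters A)) =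
        TopologicalSpace.induced (charKerIdeal A) (tauW A))
    {P : ClosedIdeals A} (hP : P ∈ SemisimplePrimeSet A) : ∃ χ, charKerIdeal A χ = P := by
  obtain ⟨χ, hχ⟩ := exists_char_of_semisimplePrime A hP
  have huniq : ∀ ψ : Characters A, P.1 ⊆ charKer A ψ.1 → ψ = χ := by
    intro ψ hψ
    by_contra hne
    obtain ⟨U, V, hU, hV, hψU, hχV, hdisj⟩ := t2_separation hne
    have hU' : IsOpen[TopologicalSpace.induced (charKerIdeal A) (tauW A)] U := by rwa [← hT]
    have hV' : IsOpen[TopologicalSpace.induced (charKerIdeal A) (tauW A)] V := by rwa [← hT]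
    obtain ⟨U, hUo, rfl⟩ := hU'
    obtain ⟨V, hVo, rfl⟩ := hV'
    obtain ⟨x, hx, hxU⟩ := tauW_base A hUo ψ hψU
    obtain ⟨z, hz, hzV⟩ := tauW_base A hVo χ hχV
    have hor : ∀ θ : Characters A, θ.1 x = 0 ∨ θ.1 z = 0 := by
      intro θ
      by_contra! h
      exact Set.disjoint_left.1 hdisj (hxU θ h.1) (hzV θ h.2)
    have := hP.1.2.2 (genIdeal A x) (genIdeal A z) (by
      intro v hv w hw
      rw [hP.2]
      simp only [Set.mem_iInter]
      intro θ _
      show θ.1 (v * w) = 0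
      rw [char_mul]
      rcases hor θ with h | h
      · have h' : v ∈ charKer A θ.1 := genIdeal_subset A (I := charKerIdeal A θ) h hv
        rw [show θ.1 v = 0 from h', zero_mul]
      · have h' : w ∈ charKer A θ.1 := genIdeal_subset A (I := charKerIdeal A θ) h hw
        rw [show θ.1 w = 0 from h', mul_zero])
    rcases this with h | h
    · exact hx (hψ (h (mem_genIdeal A x)))
    · exact hz (hχ (h (mem_genIdeal A z)))
  refine ⟨χ, Subtype.ext (subset_antisymm ?_ hχ)⟩
  intro x hx
  rw [hP.2]
  simp only [Set.mem_iInter]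
  intro ψ hψ
  rw [huniq ψ hψ]
  exact hx

theorem backward_locallyCompact
    (hT : (inferInstance : TopologicalSpace (Characters A)) =
        TopologicalSpace.induced (charKerIdeal A) (tauW A)) :
    @LocallyCompactSpace (SemisimplePrimeSet A)
        (restrictTop A (SemisimplePrimeSet A) (tauW A)) := by
  let tw : TopologicalSpace (ClosedIdeals A) := tauW A
  let tS : TopologicalSpace (SemisimplePrimeSet A) :=
    restrictTop A (SemisimplePrimeSet A) (tauW A)
  let g : Characters A → SemisimplePrimeSet A := fun φ => ⟨charKerIdeal A φ, charKer_prime A φ⟩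
  have hg : Function.Bijective g := by
    constructor
    · intro φ ψ h
      apply char_ext
      have h1 : (g φ).1.1 = (g ψ).1.1 := by rw [h]
      exact h1.subset
    · rintro ⟨P, hP⟩
      obtain ⟨χ, rfl⟩ := semisimplePrime_eq A hT hP
      exact ⟨χ, rfl⟩
  have hind : IsInducing g := ⟨by
    refine hT.trans ?_
    show _ = TopologicalSpace.induced g (TopologicalSpace.induced Subtype.val (tauW A))
    rw [induced_compose]
    rfl⟩
  have := characters_locallyCompact A
  exact ((Equiv.ofBijective g hg).toHomeomorphOfIsInducing hind).symm.isClosedEmbedding.locallyCompactSpace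

/-- Corollary 1.7 of the paper: a commutative Banach algebra has spectral synthesis
in the sense of the paper (conditions (i′), (ii′), (iii′)) if and only if it has
spectral synthesis in the usual sense. -/
theorem spectral_synthesis_paper_iff_usual
    (hcomm : ∀ x y : A, x * y = y * x) :
    (@LocallyCompactSpace (SemisimplePrimeSet A)
        (restrictTop A (SemisimplePrimeSet A) (tauW A)) ∧
      HasNormality A (PrimSet A) (restrictTop A (PrimSet A) (tauW A)) ∧
      (∀ I : ClosedIdeals A, I.1 ≠ Set.univ →
        I.1 = ⋂ (φ : Characters A), ⋂ (_ : I.1 ⊆ charKer A φ.1), charKer A φ.1)) ↔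
    (restrictTop A (PrimSet A) (tauW A) = gelfandTop A ∧
      ∀ I : ClosedIdeals A, I.1 ≠ Set.univ →
        I.1 = ⋂ (φ : Characters A), ⋂ (_ : I.1 ⊆ charKer A φ.1), charKer A φ.1) := by
  constructor
  · rintro ⟨hL, hN, hI⟩
    exact ⟨forward A hL hN, hI⟩
  · rintro ⟨hT, hI⟩
    have hT' := (top_eq_iff A).1 hT
    exact ⟨backward_locallyCompact A hT', backward_normality A hT', hI⟩

end BanachAlgebraPrelude
end
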